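/- Consider the model y = Π*Xβ* + ε with Π* a k-sparse permutation matrix, X ∈ ℝ^{n×d} with i.i.d. N(0,1) entries, and ε with i.i.d. N(0,σ²) entries independent of X. Let (Π̂, β̂) minimize ‖ΠXβ − y‖₂² over k-sparse permutation matrices Π and β ∈ ℝ^d. For positive integers m let ν_m = E_{g∼N(0,I_m)}[‖g‖₂], and let ε₀ ∈ (0,1/2) satisfy ν_{n−d} − (ε₀/(1−ε₀))·ν_n ≥ (2/(1−ε₀))·w(T). If n > max(9, 4d), then there is a constant c_{ε₀} > 0 depending only on ε₀ and d/n such that with probability at least 1 − (7/2)·exp(−c_{ε₀}·n) − 2·exp(−(1/2)·max(d, log n)), one has ‖β̂ − β*‖₂ ≤ [σ/(1 − √(max(4d, log n)/n))] · ( √(5·max(d, log n)/n) + 2(1+√2)·ε₀^{−2}·max(w(T), log n)/√n ). -/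

import Mathlib

open MeasureTheory ProbabilityTheory Matrix

noncomputable section

def l2 {n : ℕ} (v : Fin n → ℝ) : ℝ := Real.sqrt (∑ i, v i ^ 2)

def permVec {n : ℕ} (σ : Equiv.Perm (Fin n)) (v : Fin n → ℝ) : Fin n → ℝ := fun i => v (σ i)

/-- Hamming distance of (the matrix of) a permutation to the identity. -/
def dH {n : ℕ} (σ : Equiv.Perm (Fin n)) : ℕ := (Finset.univ.filter fun i => σ i ≠ i).card

abbrev stdGaussian : Measure ℝ := gaussianReal 0 1

abbrev gaussPi (m : ℕ) : Measure (Fin m → ℝ) := Measure.pi fun _ => stdGaussian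

abbrev μX (n d : ℕ) : Measure (Fin n → Fin d → ℝ) := Measure.pi fun _ => gaussPi d

abbrev μNoise (n : ℕ) (σ : ℝ) : Measure (Fin n → ℝ) :=
  Measure.pi fun _ => gaussianReal 0 ⟨σ ^ 2, sq_nonneg σ⟩

abbrev μData (n d : ℕ) (σ : ℝ) : Measure ((Fin n → Fin d → ℝ) × (Fin n → ℝ)) :=
  (μX n d).prod (μNoise n σ)

abbrev Ω (n d : ℕ) := (Fin n → Fin d → ℝ) × (Fin n → ℝ)

abbrev desX {n d : ℕ} (ω : Ω n d) : Matrix (Fin n) (Fin d) ℝ := Matrix.of ω.1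

/-- Gaussian width of a set `K ⊆ ℝⁿ`. -/
def gwidth {n : ℕ} (K : Set (Fin n → ℝ)) : ℝ :=
  ∫ g, sSup ((fun x => |∑ i, g i * x i|) '' K) ∂(gaussPi n)

/-- `ν m`: expected Euclidean norm of a standard Gaussian vector in `ℝ^m`. -/
def nu (m : ℕ) : ℝ := ∫ g, l2 g ∂(gaussPi m)

/-- The set `T = (⋃_{Π ∈ P_{n,k}} range(Π - Π*ᵀ)) ∩ S^{n-1}`. -/
def setT (n k : ℕ) (πs : Equiv.Perm (Fin n)) : Set (Fin n → ℝ) :=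
  {w | (∃ σ : Equiv.Perm (Fin n), dH σ ≤ k ∧ ∃ v : Fin n → ℝ,
          w = permVec σ v - permVec πs⁻¹ v) ∧ l2 w = 1}

/-! ### Basic facts on `l2` -/

lemma l2_eq_norm {n : ℕ} (v : Fin n → ℝ) : l2 v = ‖WithLp.toLp 2 v‖ := by
  simp [l2, EuclideanSpace.norm_eq]

lemma l2_nonneg {n : ℕ} (v : Fin n → ℝ) : 0 ≤ l2 v := Real.sqrt_nonneg _

lemma l2_sq {n : ℕ} (v : Fin n → ℝ) : l2 v ^ 2 = v ⬝ᵥ v := by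
  rw [l2, Real.sq_sqrt (Finset.sum_nonneg fun i _ => sq_nonneg _)]
  simp [dotProduct, sq]

lemma l2_add_le {n : ℕ} (v w : Fin n → ℝ) : l2 (v + w) ≤ l2 v + l2 w := by
  simp only [l2_eq_norm, WithLp.toLp_add]; exact norm_add_le _ _

lemma l2_smul {n : ℕ} (a : ℝ) (v : Fin n → ℝ) : l2 (a • v) = |a| * l2 v := by
  simp only [l2_eq_norm, WithLp.toLp_smul, norm_smul, Real.norm_eq_abs]

lemma l2_neg {n : ℕ} (v : Fin n → ℝ) : l2 (-v) = l2 v := by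
  simp only [l2_eq_norm, WithLp.toLp_neg, norm_neg]

lemma l2_zero {n : ℕ} : l2 (0 : Fin n → ℝ) = 0 := by simp [l2]

lemma l2_eq_zero {n : ℕ} {v : Fin n → ℝ} (h : l2 v = 0) : v = 0 := by
  rw [l2_eq_norm, norm_eq_zero] at h
  simpa using h

lemma dot_le_l2 {n : ℕ} (v w : Fin n → ℝ) : v ⬝ᵥ w ≤ l2 v * l2 w := by
  have := real_inner_le_norm (WithLp.toLp 2 w) (WithLp.toLp 2 v)
  rw [l2_eq_norm, l2_eq_norm, mul_comm]
  refine le_trans (le_of_eq ?_) this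
  simp [dotProduct, PiLp.inner_apply]

lemma abs_dot_le_l2 {n : ℕ} (v w : Fin n → ℝ) : |v ⬝ᵥ w| ≤ l2 v * l2 w := by
  rw [abs_le]
  refine ⟨?_, dot_le_l2 v w⟩
  have := dot_le_l2 (-v) w
  rw [neg_dotProduct, l2_neg] at this
  linarith

lemma continuous_l2 {n : ℕ} : Continuous (l2 : (Fin n → ℝ) → ℝ) := by
  unfold l2; fun_prop

/-! ### Gaussian facts -/

lemma isGaussian_pi' {ι : Type*} [Fintype ι] {E : Type*} [NormedAddCommGroup E] [NormedSpace ℝ E]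
    [MeasurableSpace E] [BorelSpace E] [SecondCountableTopology E] [CompleteSpace E]
    (μ : Measure E) [IsGaussian μ] : IsGaussian (Measure.pi fun _ : ι => μ) := by
  have h1 : iIndepFun (fun (i : ι) (ω : ι → E) => ω i) (Measure.pi fun _ : ι => μ) :=
    iIndepFun_pi (X := fun _ => id) (fun i => by fun_prop)
  have h2 : ∀ i : ι, HasGaussianLaw (fun ω : ι → E => ω i) (Measure.pi fun _ : ι => μ) := by
    intro i
    refine ⟨?_⟩
    have := (measurePreserving_eval (fun _ : ι => μ) i).map_eq
    have h3 : Measure.map (fun ω : ι → E => ω i) (Measure.pi fun _ : ι => μ) = μ := this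
    rw [h3]; infer_instance
  have := (iIndepFun.hasGaussianLaw h2 h1).isGaussian_map
  simpa using this

instance isGaussian_gaussPi (m : ℕ) : IsGaussian (gaussPi m) := isGaussian_pi' _

instance isGaussian_muX (n d : ℕ) : IsGaussian (μX n d) := isGaussian_pi' _

/-- second moments of sums of independent centred variables -/
lemma pi_second_moment {ι : Type*} [Fintype ι] {E : Type*} [MeasurableSpace E]
    (μ : Measure E) [IsProbabilityMeasure μ] (f g : ι → E → ℝ)
    (hf : ∀ i, MemLp (f i) 2 μ) (hg : ∀ i, MemLp (g i) 2 μ)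
    (hf0 : ∀ i, ∫ x, f i x ∂μ = 0) :
    ∫ ω, (∑ i, f i (ω i)) * (∑ j, g j (ω j)) ∂(Measure.pi fun _ : ι => μ)
      = ∑ i, ∫ x, f i x * g i x ∂μ := by
  classical
  have mp : ∀ i : ι, MeasurePreserving (fun ω : ι → E => ω i) (Measure.pi fun _ : ι => μ) μ :=
    fun i => measurePreserving_eval (fun _ : ι => μ) i
  have hf' : ∀ i, MemLp (fun ω : ι → E => f i (ω i)) 2 (Measure.pi fun _ : ι => μ) :=
    fun i => (hf i).comp_measurePreserving (mp i)
  have hg' : ∀ i, MemLp (fun ω : ι → E => g i (ω i)) 2 (Measure.pi fun _ : ι => μ) :=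
    fun i => (hg i).comp_measurePreserving (mp i)
  have hinteg : ∀ i j, Integrable (fun ω : ι → E => f i (ω i) * g j (ω j))
      (Measure.pi fun _ : ι => μ) := fun i j => (hf' i).integrable_mul (hg' j)
  have evalint : ∀ (i : ι) (h : E → ℝ), AEStronglyMeasurable h μ →
      ∫ ω, h (ω i) ∂(Measure.pi fun _ : ι => μ) = ∫ x, h x ∂μ := by
    intro i h hh
    have h1 := integral_map (μ := Measure.pi fun _ : ι => μ) (φ := fun ω : ι → E => ω i)
      (mp i).measurable.aemeasurable (f := h) (by rw [(mp i).map_eq]; exact hh)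
    rw [← h1, (mp i).map_eq]
  simp_rw [Finset.sum_mul_sum]
  rw [integral_finsetSum _ (fun i _ => integrable_finsetSum _ fun j _ => hinteg i j)]
  refine Finset.sum_congr rfl fun i _ => ?_
  rw [integral_finsetSum _ (fun j _ => hinteg i j)]
  rw [Finset.sum_eq_single i]
  · exact evalint i (fun x => f i x * g i x) ((hf i).1.mul (hg i).1)
  · intro j _ hji
    have hind : iIndepFun (fun (i : ι) (ω : ι → E) => ω i) (Measure.pi fun _ : ι => μ) :=
      iIndepFun_pi (X := fun _ => id) (fun i => by fun_prop)
    have h2 : IndepFun (fun ω : ι → E => f i (ω i)) (fun ω => g j (ω j))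
        (Measure.pi fun _ : ι => μ) := by
      refine (hind.indepFun hji.symm).comp₀ (mp i).measurable.aemeasurable
        (mp j).measurable.aemeasurable (φ := f i) (ψ := g j) ?_ ?_
      · have := (mp i).map_eq
        rw [show Measure.map (fun ω : ι → E => ω i) (Measure.pi fun _ : ι => μ) = μ from this]
        exact (hf i).1.aemeasurable
      · have := (mp j).map_eq
        rw [show Measure.map (fun ω : ι → E => ω j) (Measure.pi fun _ : ι => μ) = μ from this]
        exact (hg j).1.aemeasurable
    rw [h2.integral_fun_mul_eq_mul_integral (hf' i).1 (hg' j).1, evalint i (f i) (hf i).1,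
      hf0 i, zero_mul]
  · simp

lemma memLp_id_gauss : MemLp (fun x : ℝ => x) 2 (gaussianReal 0 1) :=
  IsGaussian.memLp_two_id (μ := gaussianReal 0 1)

lemma integral_sq_gauss : ∫ x, x * x ∂(gaussianReal 0 1) = 1 := by
  have h := variance_id_gaussianReal (μ := 0) (v := 1)
  rw [variance_eq_integral (by fun_prop)] at h
  simpa [sq] using h

lemma gaussPi_cov {n : ℕ} (a b : Fin n → ℝ) :
    ∫ g, (a ⬝ᵥ g) * (b ⬝ᵥ g) ∂(gaussPi n) = a ⬝ᵥ b := by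
  have := pi_second_moment (ι := Fin n) (gaussianReal 0 1) (fun i x => a i * x)
    (fun i x => b i * x) (fun i => memLp_id_gauss.const_mul _) (fun i => memLp_id_gauss.const_mul _)
    (fun i => by rw [integral_const_mul, integral_id_gaussianReal, mul_zero])
  simp only [dotProduct]
  rw [this]
  refine Finset.sum_congr rfl fun i _ => ?_
  calc ∫ x, a i * x * (b i * x) ∂(gaussianReal 0 1)
      = ∫ x, (a i * b i) * (x * x) ∂(gaussianReal 0 1) := by congr 1; ext x; ring
    _ = a i * b i := by rw [integral_const_mul, integral_sq_gauss, mul_one]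

lemma gaussPi_memLp {n : ℕ} (a : Fin n → ℝ) : MemLp (fun g => a ⬝ᵥ g) 2 (gaussPi n) := by
  simp only [dotProduct]
  refine memLp_finsetSum _ fun i _ => ?_
  exact (memLp_id_gauss.comp_measurePreserving
    (measurePreserving_eval (fun _ : Fin n => gaussianReal 0 1) i)).const_mul (a i)

lemma gaussPi_mean {n : ℕ} (a : Fin n → ℝ) : ∫ g, a ⬝ᵥ g ∂(gaussPi n) = 0 := by
  simp only [dotProduct]
  rw [integral_finsetSum]
  · refine Finset.sum_eq_zero fun i _ => ?_
    rw [integral_const_mul, integral_eval]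
    simp
  · intro i _
    exact ((memLp_id_gauss.comp_measurePreserving
      (measurePreserving_eval (fun _ : Fin n => gaussianReal 0 1) i)).const_mul (a i)).integrable
        (by norm_num)

lemma muX_cov {n d : ℕ} (v v' : Fin n → ℝ) (u u' : Fin d → ℝ) :
    ∫ X, (v ⬝ᵥ fun i => u ⬝ᵥ X i) * (v' ⬝ᵥ fun i => u' ⬝ᵥ X i) ∂(μX n d)
      = (v ⬝ᵥ v') * (u ⬝ᵥ u') := by
  have := pi_second_moment (ι := Fin n) (gaussPi d) (fun i x => v i * (u ⬝ᵥ x))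
    (fun i x => v' i * (u' ⬝ᵥ x)) (fun i => (gaussPi_memLp u).const_mul _)
    (fun i => (gaussPi_memLp u').const_mul _)
    (fun i => by rw [integral_const_mul, gaussPi_mean, mul_zero])
  simp only [dotProduct] at this ⊢
  rw [this, Finset.sum_mul]
  refine Finset.sum_congr rfl fun i _ => ?_
  have h2 := gaussPi_cov u u'
  simp only [dotProduct] at h2
  rw [← h2, ← integral_const_mul]
  congr 1; ext x; ring

lemma gaussPi_isProb (n : ℕ) : IsProbabilityMeasure (gaussPi n) := inferInstance

/-- rotation invariance for centred Gaussian measures, in the form we use -/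
lemma gaussPi_integral_id (n : ℕ) : ∫ g, g ∂(gaussPi n) = 0 := by
  ext i
  rw [eval_integral]
  · rw [integral_eval]; simp
  · intro i
    exact (memLp_id_gauss.comp_measurePreserving
      (measurePreserving_eval (fun _ : Fin n => gaussianReal 0 1) i)).integrable (by norm_num)

/-- orthogonal invariance -/
lemma gaussPi_map_orth {n : ℕ} (A : Matrix (Fin n) (Fin n) ℝ) (hA : Aᵀ * A = 1) :
    (gaussPi n).map (fun g => A *ᵥ g) = gaussPi n := by
  have key : ∀ t : EuclideanSpace ℝ (Fin n), charFun ((gaussPi n).map (WithLp.toLp 2)) t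
      = Complex.exp (- ‖t‖ ^ 2 / 2) := by
    intro t
    rw [map_pi_eq_stdGaussian, charFun_stdGaussian]
  have h : ((gaussPi n).map (fun g => A *ᵥ g)).map (WithLp.toLp 2)
      = (gaussPi n).map (WithLp.toLp 2 : (Fin n → ℝ) → EuclideanSpace ℝ (Fin n)) := by
    have hm : Measurable (fun g : Fin n → ℝ => A *ᵥ g) := by
      have : Continuous (fun g : Fin n → ℝ => A *ᵥ g) := by fun_prop
      exact this.measurable
    have hp : IsProbabilityMeasure ((gaussPi n).map (fun g => A *ᵥ g)) :=
      Measure.isProbabilityMeasure_map hm.aemeasurable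
    have hp1 : IsProbabilityMeasure (((gaussPi n).map (fun g => A *ᵥ g)).map
      (WithLp.toLp 2 : (Fin n → ℝ) → EuclideanSpace ℝ (Fin n))) :=
      Measure.isProbabilityMeasure_map (by fun_prop)
    have hp2 : IsProbabilityMeasure ((gaussPi n).map
      (WithLp.toLp 2 : (Fin n → ℝ) → EuclideanSpace ℝ (Fin n))) :=
      Measure.isProbabilityMeasure_map (by fun_prop)
    apply Measure.ext_of_charFun
    ext t
    rw [key]
    have e1 : charFun (((gaussPi n).map (fun g => A *ᵥ g)).map (WithLp.toLp 2)) t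
        = charFun ((gaussPi n).map (WithLp.toLp 2)) (WithLp.toLp 2 (Aᵀ *ᵥ t.ofLp)) := by
      rw [charFun_apply, charFun_apply, integral_map (by fun_prop) (by fun_prop),
        integral_map hm.aemeasurable (by fun_prop), integral_map (by fun_prop) (by fun_prop)]
      congr 1; ext g
      congr 3
      simp only [PiLp.inner_apply, RCLike.inner_apply, conj_trivial]
      have : t.ofLp ⬝ᵥ (A *ᵥ g) = (Aᵀ *ᵥ t.ofLp) ⬝ᵥ g := by
        rw [dotProduct_mulVec, mulVec_transpose]
      simpa [dotProduct] using this
    have e2 : ‖(WithLp.toLp 2 (Aᵀ *ᵥ t.ofLp) : EuclideanSpace ℝ (Fin n))‖ ^ 2 = ‖t‖ ^ 2 := by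
      have h1 : A * Aᵀ = 1 := mul_eq_one_comm.mp hA
      have : ‖t‖ = l2 t.ofLp := by rw [l2_eq_norm]
      rw [this, ← l2_eq_norm, l2_sq, l2_sq, dotProduct_mulVec, vecMul_transpose, mulVec_mulVec, h1,
        one_mulVec]
    rw [e1, key, ← Complex.ofReal_pow, e2, Complex.ofReal_pow]
  have hinj := congrArg (Measure.map (WithLp.ofLp : EuclideanSpace ℝ (Fin n) → (Fin n → ℝ))) h
  have hid : ∀ ν : Measure (Fin n → ℝ),
      (ν.map (WithLp.toLp 2)).map (WithLp.ofLp : EuclideanSpace ℝ (Fin n) → (Fin n → ℝ)) = ν := by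
    intro ν
    rw [Measure.map_map (by fun_prop) (by fun_prop)]
    exact Measure.map_id
  rwa [hid, hid] at hinj

/-! ### Tail bounds -/

/-- the continuous linear functional `g ↦ t ⬝ᵥ g` -/
def dotCLM {n : ℕ} (t : Fin n → ℝ) : (Fin n → ℝ) →L[ℝ] ℝ :=
  LinearMap.toContinuousLinearMap
    { toFun := fun g => t ⬝ᵥ g
      map_add' := fun x y => dotProduct_add t x y
      map_smul' := fun a x => by simp [dotProduct_smul] }

lemma dotCLM_apply {n : ℕ} (t g : Fin n → ℝ) : dotCLM t g = t ⬝ᵥ g := rfl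

lemma gauss_tail {n : ℕ} (t : Fin n → ℝ) (ht : l2 t ≤ 1) {τ : ℝ} (hτ : 0 ≤ τ) :
    gaussPi n {g | τ ≤ t ⬝ᵥ g} ≤ ENNReal.ofReal (Real.exp (-τ ^ 2 / 2)) := by
  have hmap := IsGaussian.map_eq_gaussianReal (μ := gaussPi n) (dotCLM t)
  have hmean : (gaussPi n)[dotCLM t] = 0 := gaussPi_mean t
  have hvar : Var[dotCLM t; gaussPi n] = t ⬝ᵥ t := by
    rw [variance_eq_integral (by fun_prop), hmean]
    simp only [sub_zero, sq]
    exact gaussPi_cov t t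
  rw [hmean, hvar] at hmap
  have hmgf : ∀ s, mgf (fun g => dotCLM t g) (gaussPi n) s = Real.exp ((t ⬝ᵥ t) * s ^ 2 / 2) := by
    intro s
    have := mgf_gaussianReal hmap s
    rw [this]
    rw [Real.coe_toNNReal _ (by rw [← l2_sq]; positivity)]
    simp
  have hinteg : Integrable (fun g => Real.exp (τ * dotCLM t g)) (gaussPi n) := by
    by_contra h
    have := hmgf τ
    rw [mgf, integral_undef h] at this
    exact absurd this.symm (Real.exp_pos _).ne'
  have := measure_ge_le_exp_mul_mgf (μ := gaussPi n) (X := fun g => dotCLM t g) τ hτ hinteg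
  rw [hmgf, ← Real.exp_add] at this
  have h2 : (gaussPi n).real {g | τ ≤ t ⬝ᵥ g} ≤ Real.exp (-τ ^ 2 / 2) := by
    refine le_trans this (Real.exp_le_exp.mpr ?_)
    have : t ⬝ᵥ t ≤ 1 := by
      rw [← l2_sq]; have := l2_nonneg t; nlinarith
    nlinarith [sq_nonneg τ]
  rw [← ENNReal.ofReal_toReal (measure_ne_top (gaussPi n) {g | τ ≤ t ⬝ᵥ g})]
  exact ENNReal.ofReal_le_ofReal h2

lemma gauss_exp_sq {x : ℝ} (hx : -1 < x) :
    Integrable (fun y : ℝ => Real.exp (x / (2 * (1 + x)) * y ^ 2)) (gaussianReal 0 1) ∧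
    ∫ y, Real.exp (x / (2 * (1 + x)) * y ^ 2) ∂(gaussianReal 0 1) = Real.sqrt (1 + x) := by
  have h1 : 0 < 1 + x := by linarith
  have hb : 0 < 1 / (2 * (1 + x)) := by positivity
  have e : ∀ y : ℝ, gaussianPDFReal 0 1 y • Real.exp (x / (2 * (1 + x)) * y ^ 2)
      = (Real.sqrt (2 * Real.pi))⁻¹ * Real.exp (-(1 / (2 * (1 + x))) * y ^ 2) := by
    intro y
    simp only [gaussianPDFReal, smul_eq_mul, NNReal.coe_one, mul_one, sub_zero, mul_assoc]
    rw [← Real.exp_add]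
    congr 2
    field_simp
    ring
  have hinteg : ∫ y, Real.exp (x / (2 * (1 + x)) * y ^ 2) ∂(gaussianReal 0 1)
      = Real.sqrt (1 + x) := by
    rw [integral_gaussianReal_eq_integral_smul (by norm_num)]
    simp_rw [e]
    rw [integral_const_mul, integral_gaussian, ← Real.sqrt_inv, ← Real.sqrt_mul (by positivity)]
    congr 1
    have := Real.pi_pos
    field_simp
  refine ⟨?_, hinteg⟩
  by_contra h
  rw [integral_undef h] at hinteg
  exact absurd hinteg.symm (Real.sqrt_pos.mpr h1).ne'

/-- the Chernoff rate for `χ²` -/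
def chiRate (x : ℝ) : ℝ := Real.sqrt (1 + x) * Real.exp (-x / 2)

lemma chiRate_pos {x : ℝ} (hx : -1 < x) : 0 < chiRate x := by
  have : 0 < 1 + x := by linarith
  unfold chiRate; positivity

lemma chiRate_lt_one {x : ℝ} (hx : -1 < x) (hx0 : x ≠ 0) : chiRate x < 1 := by
  have h1 : 0 < 1 + x := by linarith
  have h : 1 + x < Real.exp x := by have := Real.add_one_lt_exp hx0; linarith
  have h2 : Real.sqrt (1 + x) < Real.exp (x / 2) := by
    rw [Real.sqrt_lt' (Real.exp_pos _), ← Real.exp_nat_mul]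
    convert h using 2; push_cast; ring
  unfold chiRate
  calc Real.sqrt (1 + x) * Real.exp (-x / 2) < Real.exp (x / 2) * Real.exp (-x / 2) :=
        mul_lt_mul_of_pos_right h2 (Real.exp_pos _)
    _ = 1 := by rw [← Real.exp_add, ← Real.exp_zero]; congr 1; ring

lemma chi_tail {x : ℝ} (hx : -1 < x) (m : ℕ) :
    gaussPi m {g | 0 ≤ x / (2 * (1 + x)) * (l2 g ^ 2 - (1 + x) * m)}
      ≤ ENNReal.ofReal (chiRate x ^ m) := by
  set θ := x / (2 * (1 + x)) with hθ
  obtain ⟨hi, hv⟩ := gauss_exp_sq hx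
  have h1 : 0 < 1 + x := by linarith
  have hprod : ∀ g : Fin m → ℝ, Real.exp (θ * (l2 g ^ 2 - (1 + x) * m))
      = Real.exp (-(x / 2) * m) * ∏ i, Real.exp (θ * g i ^ 2) := by
    intro g
    rw [← Real.exp_sum, ← Real.exp_add, l2, Real.sq_sqrt (by positivity), ← Finset.mul_sum]
    congr 1
    have : θ * (1 + x) = x / 2 := by rw [hθ]; field_simp
    linear_combination (-(m : ℝ)) * this
  have hinteg : Integrable (fun g : Fin m → ℝ => Real.exp (θ * (l2 g ^ 2 - (1 + x) * m)))
      (gaussPi m) := by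
    simp_rw [hprod]
    refine Integrable.const_mul ?_ _
    exact Integrable.fintype_prod (fun i => hi)
  have hval : ∫ g : Fin m → ℝ, Real.exp (θ * (l2 g ^ 2 - (1 + x) * m)) ∂(gaussPi m)
      = chiRate x ^ m := by
    simp_rw [hprod]
    rw [integral_const_mul,
      integral_fintype_prod_eq_prod (f := fun (_ : Fin m) (y : ℝ) => Real.exp (θ * y ^ 2))]
    rw [Finset.prod_congr rfl (fun i _ => hv)]
    simp only [Finset.prod_const, Finset.card_univ, Fintype.card_fin, chiRate, mul_pow]
    rw [← Real.exp_nat_mul, mul_comm]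
    congr 2; ring
  have hM := mul_meas_ge_le_integral_of_nonneg (μ := gaussPi m)
    (Filter.Eventually.of_forall fun g => (Real.exp_pos _).le) hinteg 1
  rw [hval, one_mul] at hM
  have hset : {g : Fin m → ℝ | 0 ≤ θ * (l2 g ^ 2 - (1 + x) * m)}
      = {g | 1 ≤ Real.exp (θ * (l2 g ^ 2 - (1 + x) * m))} := by
    ext g; simp [Real.one_le_exp_iff]
  rw [hset, ← ENNReal.ofReal_toReal (measure_ne_top (gaussPi m) _)]
  exact ENNReal.ofReal_le_ofReal hM

lemma chi_upper {x : ℝ} (hx : 0 < x) (m : ℕ) :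
    gaussPi m {g | ¬ l2 g ^ 2 ≤ (1 + x) * m} ≤ ENNReal.ofReal (chiRate x ^ m) := by
  refine le_trans (measure_mono ?_) (chi_tail (by linarith) m)
  intro g hg
  simp only [Set.mem_setOf_eq, not_le] at hg ⊢
  have : 0 < x / (2 * (1 + x)) := by positivity
  nlinarith

lemma chi_lower {x : ℝ} (hx : 0 < x) (hx1 : x < 1) (m : ℕ) :
    gaussPi m {g | ¬ (1 - x) * m ≤ l2 g ^ 2} ≤ ENNReal.ofReal (chiRate (-x) ^ m) := by
  refine le_trans (measure_mono ?_) (chi_tail (x := -x) (by linarith) m)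
  intro g hg
  simp only [Set.mem_setOf_eq, not_le] at hg ⊢
  have : -x / (2 * (1 + -x)) ≤ 0 :=
    div_nonpos_of_nonpos_of_nonneg (by linarith) (by linarith)
  have h3 : l2 g ^ 2 - (1 + -x) * m ≤ 0 := by linarith [hg.le]
  exact mul_nonneg_of_nonpos_of_nonpos this h3

/-! ### Concentration for suprema of Gaussian linear forms -/

lemma cont_dot {n : ℕ} (t : Fin n → ℝ) : Continuous (fun g : Fin n → ℝ => t ⬝ᵥ g) := by
  fun_prop

lemma conc_aux {n : ℕ} (S : Finset (Fin n → ℝ)) (hS : ∀ t ∈ S, l2 t ≤ 1) (hne : S.Nonempty)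
    {τ : ℝ} (hτ : 0 ≤ τ) :
    MeasurableSet {z : (Fin n → ℝ) × (Fin n → ℝ) |
        ∀ t ∈ S, (∃ t' ∈ S, t ⬝ᵥ z.1 < t' ⬝ᵥ z.1) ∨ t ⬝ᵥ z.2 ≤ -τ} ∧
    (gaussPi n).prod (gaussPi n) {z : (Fin n → ℝ) × (Fin n → ℝ) |
        ∀ t ∈ S, (∃ t' ∈ S, t ⬝ᵥ z.1 < t' ⬝ᵥ z.1) ∨ t ⬝ᵥ z.2 ≤ -τ}
      ≤ ENNReal.ofReal (Real.exp (-τ ^ 2 / 2)) := by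
  have hm : MeasurableSet {z : (Fin n → ℝ) × (Fin n → ℝ) |
        ∀ t ∈ S, (∃ t' ∈ S, t ⬝ᵥ z.1 < t' ⬝ᵥ z.1) ∨ t ⬝ᵥ z.2 ≤ -τ} := by
    have : {z : (Fin n → ℝ) × (Fin n → ℝ) |
        ∀ t ∈ S, (∃ t' ∈ S, t ⬝ᵥ z.1 < t' ⬝ᵥ z.1) ∨ t ⬝ᵥ z.2 ≤ -τ}
        = ⋂ t ∈ S, ((⋃ t' ∈ S, {z : (Fin n → ℝ) × (Fin n → ℝ) | t ⬝ᵥ z.1 < t' ⬝ᵥ z.1}) ∪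
          {z | t ⬝ᵥ z.2 ≤ -τ}) := by
      ext z; simp
    rw [this]
    refine Finset.measurableSet_biInter _ fun t _ => MeasurableSet.union
      (Finset.measurableSet_biUnion _ fun t' _ => ?_) ?_
    · exact (isOpen_lt (by fun_prop) (by fun_prop)).measurableSet
    · exact (isClosed_le (by fun_prop) (by fun_prop)).measurableSet
  refine ⟨hm, ?_⟩
  rw [Measure.prod_apply hm]
  calc _ ≤ ∫⁻ _, ENNReal.ofReal (Real.exp (-τ ^ 2 / 2)) ∂(gaussPi n) := by
        refine lintegral_mono fun g => ?_
        obtain ⟨t0, ht0, hmax⟩ := S.exists_max_image (fun t => t ⬝ᵥ g) hne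
        refine le_trans (measure_mono ?_) (gauss_tail (-t0) (by rw [l2_neg]; exact hS t0 ht0) hτ)
        intro g' hg'
        simp only [Set.mem_preimage, Set.mem_setOf_eq] at hg' ⊢
        rcases hg' t0 ht0 with ⟨t', ht', hlt⟩ | h
        · exact absurd (hmax t' ht') (not_le.mpr hlt)
        · rw [neg_dotProduct]; linarith
    _ = _ := by simp

lemma conc_finite {n : ℕ} (S : Finset (Fin n → ℝ)) (hS : ∀ t ∈ S, l2 t ≤ 1)
    {c τ : ℝ} (hτ : 0 ≤ τ) :
    gaussPi n {g | ∃ t ∈ S, 2 * c + 3 * τ < t ⬝ᵥ g} * gaussPi n {g | ∀ t ∈ S, t ⬝ᵥ g ≤ c}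
      ≤ 2 * ENNReal.ofReal (Real.exp (-τ ^ 2 / 2)) := by
  rcases S.eq_empty_or_nonempty with rfl | hne
  · simp
  obtain ⟨hm, hB⟩ := conc_aux S hS hne hτ
  set B := {z : (Fin n → ℝ) × (Fin n → ℝ) |
        ∀ t ∈ S, (∃ t' ∈ S, t ⬝ᵥ z.1 < t' ⬝ᵥ z.1) ∨ t ⬝ᵥ z.2 ≤ -τ} with hBdef
  have hrot := IsGaussian.map_rotation_eq_self (μ := gaussPi n) (gaussPi_integral_id n)
    (Real.pi / 4)
  have hB2 : (gaussPi n).prod (gaussPi n)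
      ((ContinuousLinearMap.rotation (Real.pi / 4)) ⁻¹' B)
      ≤ ENNReal.ofReal (Real.exp (-τ ^ 2 / 2)) := by
    rw [← Measure.map_apply (by fun_prop) hm, hrot]; exact hB
  rw [← Measure.prod_prod]
  calc _ ≤ (gaussPi n).prod (gaussPi n)
          (B ∪ (ContinuousLinearMap.rotation (Real.pi / 4)) ⁻¹' B) := by
        refine measure_mono ?_
        rintro ⟨g, g'⟩ ⟨⟨t0, ht0, hlt⟩, hc⟩
        by_contra hcon
        simp only [Set.mem_union, not_or, Set.mem_preimage, ContinuousLinearMap.rotation_apply,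
          hBdef, Set.mem_setOf_eq, not_forall, not_exists, not_and, not_lt, not_le,
          Real.cos_pi_div_four, Real.sin_pi_div_four, dotProduct_add, dotProduct_smul,
          smul_eq_mul, exists_prop] at hcon
        obtain ⟨⟨t, ht, h1, h2⟩, ⟨s, hs, h3, h4⟩⟩ := hcon
        have a1 := h1 t0 ht0
        have a2 := h3 t ht
        have a3 := hc s hs
        have hr : 0 < Real.sqrt 2 := by positivity
        have hr2 : Real.sqrt 2 * Real.sqrt 2 = 2 := Real.mul_self_sqrt (by norm_num)
        have hr1 : 1 ≤ Real.sqrt 2 := by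
          rw [Real.one_le_sqrt]; norm_num
        simp only at hlt
        -- multiply everything by `√2`
        have b2 : t ⬝ᵥ g + t ⬝ᵥ g' ≤ s ⬝ᵥ g + s ⬝ᵥ g' := by
          have : Real.sqrt 2 / 2 * (t ⬝ᵥ g + t ⬝ᵥ g') ≤ Real.sqrt 2 / 2 * (s ⬝ᵥ g + s ⬝ᵥ g') := by
            linarith
          exact le_of_mul_le_mul_left this (by positivity)
        have b4 : -(Real.sqrt 2 * τ) < s ⬝ᵥ g' - s ⬝ᵥ g := by
          have : Real.sqrt 2 * -τ < Real.sqrt 2 * (-(Real.sqrt 2 / 2) * s ⬝ᵥ g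
            + Real.sqrt 2 / 2 * s ⬝ᵥ g') := mul_lt_mul_of_pos_left h4 hr
          have e : Real.sqrt 2 * (-(Real.sqrt 2 / 2) * s ⬝ᵥ g
            + Real.sqrt 2 / 2 * s ⬝ᵥ g') = (Real.sqrt 2 * Real.sqrt 2) / 2 *
              (s ⬝ᵥ g' - s ⬝ᵥ g) := by ring
          rw [e, hr2] at this
          linarith
        have hr3 : Real.sqrt 2 ≤ 2 := by nlinarith
        have : Real.sqrt 2 * τ ≤ 2 * τ := mul_le_mul_of_nonneg_right hr3 hτ
        linarith
    _ ≤ _ := by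
        refine le_trans (measure_union_le _ _) ?_
        rw [two_mul]
        exact add_le_add hB hB2

lemma conc_mul {n : ℕ} (T : Set (Fin n → ℝ)) (hT : ∀ t ∈ T, l2 t ≤ 1)
    {c τ : ℝ} (hτ : 0 ≤ τ) :
    gaussPi n {g | ∃ t ∈ T, 2 * c + 3 * τ < t ⬝ᵥ g} * gaussPi n {g | ∀ t ∈ T, t ⬝ᵥ g ≤ c}
      ≤ 2 * ENNReal.ofReal (Real.exp (-τ ^ 2 / 2)) := by
  classical
  rcases T.eq_empty_or_nonempty with rfl | hne
  · simp
  have : Nonempty T := hne.to_subtype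
  let D : ℕ → T := TopologicalSpace.denseSeq T
  let S : ℕ → Finset (Fin n → ℝ) := fun m => (Finset.range m).image fun i => (D i : Fin n → ℝ)
  have hST : ∀ m, ∀ t ∈ S m, t ∈ T := by
    intro m t ht
    simp only [S, Finset.mem_image] at ht
    obtain ⟨i, _, rfl⟩ := ht
    exact (D i).2
  have hset : {g : Fin n → ℝ | ∃ t ∈ T, 2 * c + 3 * τ < t ⬝ᵥ g}
      = ⋃ m, {g | ∃ t ∈ S m, 2 * c + 3 * τ < t ⬝ᵥ g} := by
    ext g
    simp only [Set.mem_setOf_eq, Set.mem_iUnion]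
    constructor
    · rintro ⟨t, ht, hlt⟩
      have ho : IsOpen {t : T | 2 * c + 3 * τ < (t : Fin n → ℝ) ⬝ᵥ g} :=
        isOpen_lt (by fun_prop) (by fun_prop)
      obtain ⟨i, hi⟩ := (TopologicalSpace.denseRange_denseSeq T).exists_mem_open ho ⟨⟨t, ht⟩, hlt⟩
      exact ⟨i + 1, D i, Finset.mem_image.mpr ⟨i, by simp, rfl⟩, hi⟩
    · rintro ⟨m, t, ht, hlt⟩
      exact ⟨t, hST m t ht, hlt⟩
  have hmono : Monotone fun m => {g : Fin n → ℝ | ∃ t ∈ S m, 2 * c + 3 * τ < t ⬝ᵥ g} := by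
    intro a b hab g
    rintro ⟨t, ht, hlt⟩
    exact ⟨t, Finset.image_subset_image (Finset.range_mono hab) ht, hlt⟩
  rw [hset, hmono.measure_iUnion, ENNReal.iSup_mul]
  refine iSup_le fun m => ?_
  refine le_trans ?_ (conc_finite (S m) (fun t ht => hT t (hST m t ht)) (c := c) hτ)
  exact mul_le_mul' le_rfl (measure_mono (fun g h t ht => h t (hST m t ht)))

lemma conc {n : ℕ} (T : Set (Fin n → ℝ)) (hT : ∀ t ∈ T, l2 t ≤ 1)
    {c τ p : ℝ} (hτ : 0 ≤ τ) (hp : 0 < p)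
    (hc : ENNReal.ofReal p ≤ gaussPi n {g | ∀ t ∈ T, t ⬝ᵥ g ≤ c}) :
    gaussPi n {g | ∃ t ∈ T, 2 * c + 3 * τ < t ⬝ᵥ g}
      ≤ ENNReal.ofReal (2 / p * Real.exp (-τ ^ 2 / 2)) := by
  have h := conc_mul T hT (c := c) hτ
  have h2 : gaussPi n {g | ∃ t ∈ T, 2 * c + 3 * τ < t ⬝ᵥ g} * ENNReal.ofReal p
      ≤ 2 * ENNReal.ofReal (Real.exp (-τ ^ 2 / 2)) := le_trans (by gcongr) h
  have e : ENNReal.ofReal (2 / p * Real.exp (-τ ^ 2 / 2))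
      = (2 * ENNReal.ofReal (Real.exp (-τ ^ 2 / 2))) / ENNReal.ofReal p := by
    rw [← ENNReal.ofReal_ofNat 2, ← ENNReal.ofReal_mul (by norm_num), ← ENNReal.ofReal_div_of_pos hp]
    congr 1; ring
  rw [e, ENNReal.le_div_iff_mul_le (by simp [hp]) (by simp)]
  exact h2

/-! ### A class of functions with a second order Taylor expansion -/

/-- `F` has gradient `G`, Hessian `H` and a uniform third order Taylor bound. -/
structure Tay {ι : Type*} [Fintype ι] (F : (ι → ℝ) → ℝ) (G : (ι → ℝ) → ι → ℝ)
    (H : (ι → ℝ) → ι → ι → ℝ) : Prop where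
  cont : Continuous F
  bound : ∃ C : ℝ, 0 ≤ C ∧ (∀ x, |F x| ≤ C) ∧ (∀ x a, |G x a| ≤ C) ∧ (∀ x a b, |H x a b| ≤ C) ∧
    ∀ x z, |F (x + z) - F x - ∑ a, G x a * z a - (1 / 2) * ∑ a, ∑ b, H x a b * (z a * z b)|
      ≤ C * ‖z‖ ^ 3

lemma tay_lin_bound {ι : Type*} [Fintype ι] {C : ℝ} (hC : 0 ≤ C) (g z : ι → ℝ)
    (hg : ∀ a, |g a| ≤ C) : |∑ a, g a * z a| ≤ (Fintype.card ι * C) * ‖z‖ := by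
  calc |∑ a, g a * z a| ≤ ∑ a, |g a * z a| := Finset.abs_sum_le_sum_abs _ _
    _ ≤ ∑ a : ι, C * ‖z‖ := by
        refine Finset.sum_le_sum fun a _ => ?_
        rw [abs_mul]
        exact mul_le_mul (hg a) (norm_le_pi_norm z a) (abs_nonneg _) hC
    _ = _ := by simp [Finset.sum_const, mul_assoc]

lemma tay_quad_bound {ι : Type*} [Fintype ι] {C : ℝ} (hC : 0 ≤ C) (h : ι → ι → ℝ) (z : ι → ℝ)
    (hh : ∀ a b, |h a b| ≤ C) : |∑ a, ∑ b, h a b * (z a * z b)|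
      ≤ (Fintype.card ι * (Fintype.card ι * C)) * ‖z‖ ^ 2 := by
  calc |∑ a, ∑ b, h a b * (z a * z b)| = |∑ a, (∑ b, h a b * z b) * z a| := by
        congr 1; refine Finset.sum_congr rfl fun a _ => ?_
        rw [Finset.sum_mul]; refine Finset.sum_congr rfl fun b _ => by ring
    _ ≤ (Fintype.card ι * ((Fintype.card ι * C) * ‖z‖)) * ‖z‖ :=
        tay_lin_bound (by positivity) _ _ fun a => tay_lin_bound hC _ _ fun b => hh a b
    _ = _ := by ring

lemma Tay.cons {ι : Type*} [Fintype ι] {F : (ι → ℝ) → ℝ} {G : (ι → ℝ) → ι → ℝ}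
    {H : (ι → ℝ) → ι → ι → ℝ} (h : Tay F G H) :
    ∃ K : ℝ, 0 ≤ K ∧ (∀ x, |F x| ≤ K) ∧ (∀ x a, |G x a| ≤ K) ∧ (∀ x a b, |H x a b| ≤ K) ∧
      ∀ x z, |∑ a, G x a * z a| ≤ K * ‖z‖ ∧ |F (x + z) - F x| ≤ K * ‖z‖ ∧
        |F (x + z) - F x - ∑ a, G x a * z a| ≤ K * ‖z‖ ^ 2 ∧
        |F (x + z) - F x - ∑ a, G x a * z a - (1 / 2) * ∑ a, ∑ b, H x a b * (z a * z b)|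
          ≤ K * ‖z‖ ^ 3 := by
  obtain ⟨C, hC, hF, hG, hH, hT⟩ := h.bound
  set m : ℝ := (Fintype.card ι : ℝ)
  have hm : 0 ≤ m := Nat.cast_nonneg _
  have hmC : 0 ≤ m * C := by positivity
  have hmmC : 0 ≤ m * (m * C) := by positivity
  refine ⟨3 * C + m * C + m * (m * C), by positivity, fun x => (hF x).trans (by linarith),
    fun x a => (hG x a).trans (by linarith), fun x a b => (hH x a b).trans (by linarith), ?_⟩
  intro x z
  have h1 := tay_lin_bound hC (G x) z (hG x)
  have h2 := tay_quad_bound hC (H x) z (hH x)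
  have h3 := hT x z
  have h4 := hF x
  have h5 := hF (x + z)
  change _ ≤ m * C * ‖z‖ at h1
  change _ ≤ m * (m * C) * ‖z‖ ^ 2 at h2
  set N := ‖z‖
  have hN : 0 ≤ N := norm_nonneg z
  set L := ∑ a, G x a * z a
  set Q := ∑ a, ∑ b, H x a b * (z a * z b)
  rw [abs_le] at h1 h2 h3 h4 h5
  have q1 : 0 ≤ m * C * N := by positivity
  have q2 : 0 ≤ m * (m * C) * N := by positivity
  have q3 : 0 ≤ C * N := by positivity
  have q4 : 0 ≤ C * N ^ 2 := by positivity
  have q5 : 0 ≤ m * (m * C) * N ^ 2 := by positivity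
  have q6 : 0 ≤ m * C * N ^ 2 := by positivity
  have q7 : 0 ≤ C * N ^ 3 := by positivity
  have q8 : 0 ≤ m * (m * C) * N ^ 3 := by positivity
  have q9 : 0 ≤ m * C * N ^ 3 := by positivity
  rcases le_total N 1 with hN1 | hN1
  · have e2 : N ^ 2 ≤ N := by nlinarith
    have e3 : N ^ 3 ≤ N ^ 2 := by nlinarith [sq_nonneg N]
    have a1 := mul_le_mul_of_nonneg_left e2 hC
    have a2 := mul_le_mul_of_nonneg_left e3 hC
    have a3 := mul_le_mul_of_nonneg_left e2 hmmC
    refine ⟨abs_le.2 ⟨?_, ?_⟩, abs_le.2 ⟨?_, ?_⟩, abs_le.2 ⟨?_, ?_⟩, abs_le.2 ⟨?_, ?_⟩⟩ <;> linarith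
  · have e2 : N ≤ N ^ 2 := by nlinarith
    have a0 := mul_le_mul_of_nonneg_left hN1 hC
    have a1 := mul_le_mul_of_nonneg_left e2 hC
    have a2 := mul_le_mul_of_nonneg_left e2 hmC
    refine ⟨abs_le.2 ⟨?_, ?_⟩, abs_le.2 ⟨?_, ?_⟩, abs_le.2 ⟨?_, ?_⟩, abs_le.2 ⟨?_, ?_⟩⟩ <;> linarith

lemma Tay.mul {ι : Type*} [Fintype ι] {F₁ F₂ : (ι → ℝ) → ℝ} {G₁ G₂ : (ι → ℝ) → ι → ℝ}
    {H₁ H₂ : (ι → ℝ) → ι → ι → ℝ} (h₁ : Tay F₁ G₁ H₁) (h₂ : Tay F₂ G₂ H₂) :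
    Tay (fun x => F₁ x * F₂ x) (fun x a => F₁ x * G₂ x a + F₂ x * G₁ x a)
      (fun x a b => F₁ x * H₂ x a b + F₂ x * H₁ x a b + (G₁ x a * G₂ x b + G₂ x a * G₁ x b)) := by
  refine ⟨h₁.cont.mul h₂.cont, ?_⟩
  obtain ⟨K, hK, hF, hG, hH, hT⟩ := h₁.cons
  obtain ⟨K', hK', hF', hG', hH', hT'⟩ := h₂.cons
  have mb : ∀ {a b : ℝ}, |a| ≤ K → |b| ≤ K' → |a * b| ≤ K * K' := fun ha hb => by
    rw [abs_mul]; exact mul_le_mul ha hb (abs_nonneg _) hK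
  have mb' : ∀ {a b : ℝ}, |a| ≤ K → |b| ≤ K' → |b * a| ≤ K * K' := fun ha hb => by
    rw [mul_comm]; exact mb ha hb
  have hKK : 0 ≤ K * K' := by positivity
  refine ⟨4 * (K * K'), by positivity, fun x => (mb (hF x) (hF' x)).trans (by linarith), ?_, ?_, ?_⟩
  · intro x a
    refine (abs_add_le _ _).trans ?_
    have := mb (hF x) (hG' x a)
    have := mb' (hG x a) (hF' x)
    linarith
  · intro x a b
    refine (abs_add_le _ _).trans ?_
    have := mb (hF x) (hH' x a b)
    have := mb' (hH x a b) (hF' x)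
    have := mb (hG x a) (hG' x b)
    have := mb' (hG x b) (hG' x a)
    have := abs_add_le (F₁ x * H₂ x a b) (F₂ x * H₁ x a b)
    have := abs_add_le (G₁ x a * G₂ x b) (G₂ x a * G₁ x b)
    linarith
  · intro x z
    obtain ⟨l1, d1, r1, t1⟩ := hT x z
    obtain ⟨l2, d2, r2, t2⟩ := hT' x z
    have f1 := hF x
    have f2 := hF' x
    have eL : ∑ a, (F₁ x * G₂ x a + F₂ x * G₁ x a) * z a
        = F₁ x * ∑ a, G₂ x a * z a + F₂ x * ∑ a, G₁ x a * z a := by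
      rw [Finset.mul_sum, Finset.mul_sum, ← Finset.sum_add_distrib]
      refine Finset.sum_congr rfl fun a _ => by ring
    have eQ : ∑ a, ∑ b, (F₁ x * H₂ x a b + F₂ x * H₁ x a b
          + (G₁ x a * G₂ x b + G₂ x a * G₁ x b)) * (z a * z b)
        = F₁ x * ∑ a, ∑ b, H₂ x a b * (z a * z b) + F₂ x * ∑ a, ∑ b, H₁ x a b * (z a * z b)
          + 2 * ((∑ a, G₁ x a * z a) * ∑ a, G₂ x a * z a) := by
      have e1 : 2 * ((∑ a, G₁ x a * z a) * ∑ a, G₂ x a * z a)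
          = (∑ a, G₁ x a * z a) * (∑ a, G₂ x a * z a)
            + (∑ a, G₂ x a * z a) * (∑ a, G₁ x a * z a) := by ring
      rw [e1, Finset.sum_mul_sum, Finset.sum_mul_sum, Finset.mul_sum, Finset.mul_sum,
        ← Finset.sum_add_distrib, ← Finset.sum_add_distrib, ← Finset.sum_add_distrib]
      refine Finset.sum_congr rfl fun a _ => ?_
      rw [Finset.mul_sum, Finset.mul_sum,
        ← Finset.sum_add_distrib, ← Finset.sum_add_distrib, ← Finset.sum_add_distrib]
      refine Finset.sum_congr rfl fun b _ => by ring
    rw [eL, eQ]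
    set N := ‖z‖
    have hN : 0 ≤ N := norm_nonneg z
    generalize (∑ a, G₁ x a * z a) = L1 at *
    generalize (∑ a, G₂ x a * z a) = L2 at *
    generalize (∑ a, ∑ b, H₁ x a b * (z a * z b)) = Q1 at *
    generalize (∑ a, ∑ b, H₂ x a b * (z a * z b)) = Q2 at *
    generalize F₁ x = A at *
    generalize F₂ x = B at *
    generalize F₁ (x + z) = A' at *
    generalize F₂ (x + z) = B' at *
    have e : A' * B' - A * B - (A * L2 + B * L1) - 1 / 2 * (A * Q2 + B * Q1 + 2 * (L1 * L2))
        = ((A' - A - L1) * (B' - B) + L1 * (B' - B - L2))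
          + (A * (B' - B - L2 - 1 / 2 * Q2) + B * (A' - A - L1 - 1 / 2 * Q1)) := by ring
    rw [e]
    have s1 : |(A' - A - L1) * (B' - B)| ≤ (K * N ^ 2) * (K' * N) := by
      rw [abs_mul]; exact mul_le_mul r1 d2 (abs_nonneg _) (by positivity)
    have s2 : |L1 * (B' - B - L2)| ≤ (K * N) * (K' * N ^ 2) := by
      rw [abs_mul]; exact mul_le_mul l1 r2 (abs_nonneg _) (by positivity)
    have s3 : |A * (B' - B - L2 - 1 / 2 * Q2)| ≤ K * (K' * N ^ 3) := by
      rw [abs_mul]; exact mul_le_mul f1 t2 (abs_nonneg _) hK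
    have s4 : |B * (A' - A - L1 - 1 / 2 * Q1)| ≤ K' * (K * N ^ 3) := by
      rw [abs_mul]; exact mul_le_mul f2 t1 (abs_nonneg _) hK'
    refine (abs_add_le _ _).trans ((add_le_add (abs_add_le _ _) (abs_add_le _ _)).trans ?_)
    have : 4 * (K * K') * N ^ 3 = ((K * N ^ 2) * (K' * N) + (K * N) * (K' * N ^ 2))
      + (K * (K' * N ^ 3) + K' * (K * N ^ 3)) := by ring
    linarith

lemma Tay.const {ι : Type*} [Fintype ι] (c : ℝ) :
    Tay (fun _ : ι → ℝ => c) (fun _ _ => 0) (fun _ _ _ => 0) := by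
  refine ⟨continuous_const, |c|, abs_nonneg _, fun _ => le_rfl, ?_, ?_, ?_⟩ <;> intros <;> simp
  positivity

lemma Tay.one_sub {ι : Type*} [Fintype ι] {F : (ι → ℝ) → ℝ} {G : (ι → ℝ) → ι → ℝ}
    {H : (ι → ℝ) → ι → ι → ℝ} (h : Tay F G H) :
    Tay (fun x => 1 - F x) (fun x a => - G x a) (fun x a b => - H x a b) := by
  refine ⟨continuous_const.sub h.cont, ?_⟩
  obtain ⟨C, hC, hF, hG, hH, hT⟩ := h.bound
  refine ⟨1 + C, by linarith, fun x => (abs_sub _ _).trans (by simpa using hF x),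
    fun x a => ?_, fun x a b => ?_, fun x z => ?_⟩
  · rw [abs_neg]; linarith [hG x a]
  · rw [abs_neg]; linarith [hH x a b]
  · have := hT x z
    rw [← abs_neg] at this
    refine le_trans (le_of_eq ?_) (this.trans ?_)
    · congr 1
      simp only [neg_mul, Finset.sum_neg_distrib]; ring
    · have : 0 ≤ ‖z‖ ^ 3 := by positivity
      nlinarith

/-- one variable Taylor bound -/
lemma taylor_one {f f' f'' : ℝ → ℝ} (h1 : ∀ x, HasDerivAt f (f' x) x)
    (h2 : ∀ x, HasDerivAt f' (f'' x) x) {M : ℝ} (hM : 0 ≤ M)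
    (h3 : ∀ x y, |f'' x - f'' y| ≤ M * |x - y|) (x z : ℝ) :
    |f (x + z) - f x - f' x * z - (1 / 2) * (f'' x * (z * z))| ≤ M * |z| ^ 3 := by
  have hs : Convex ℝ (Metric.closedBall (0 : ℝ) |z|) := convex_closedBall _ _
  have h0 : (0 : ℝ) ∈ Metric.closedBall (0 : ℝ) |z| := by simp
  have hz : z ∈ Metric.closedBall (0 : ℝ) |z| := by simp
  have hsh : ∀ (φ φ' : ℝ → ℝ), (∀ x, HasDerivAt φ (φ' x) x) → ∀ s, HasDerivAt (fun s => φ (x + s))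
      (φ' (x + s)) s := fun φ φ' h s => HasDerivAt.comp_const_add x s (h (x + s))
  have g : ∀ s ∈ Metric.closedBall (0 : ℝ) |z|, |f' (x + s) - f' x - f'' x * s| ≤ M * |z| ^ 2 := by
    intro s hsz
    have hd : ∀ s ∈ Metric.closedBall (0 : ℝ) |z|,
        HasDerivWithinAt (fun s => f' (x + s) - f' x - f'' x * s) (f'' (x + s) - f'' x)
        (Metric.closedBall (0 : ℝ) |z|) s := by
      intro s _
      have := ((hsh f' f'' h2 s).sub_const (f' x)).sub ((hasDerivAt_id s).const_mul (f'' x))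
      refine HasDerivAt.hasDerivWithinAt ?_
      convert this using 1
      · rfl
      · ring
    have := hs.norm_image_sub_le_of_norm_hasDerivWithin_le hd (C := M * |z|) (fun s hs' => by
      have := h3 (x + s) x
      simp only [add_sub_cancel_left] at this
      rw [Real.norm_eq_abs]
      have hs2 : |s| ≤ |z| := by simpa using hs'
      exact this.trans (by gcongr)) h0 hsz
    simp only [add_zero, sub_self, mul_zero, sub_zero, Real.norm_eq_abs] at this
    refine this.trans ?_
    have hs2 : |s| ≤ |z| := by simpa using hsz
    calc M * |z| * |s| ≤ M * |z| * |z| := by gcongr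
      _ = _ := by ring
  have hd : ∀ s ∈ Metric.closedBall (0 : ℝ) |z|,
      HasDerivWithinAt (fun s => f (x + s) - f x - f' x * s - (1 / 2) * (f'' x * (s * s)))
        (f' (x + s) - f' x - f'' x * s) (Metric.closedBall (0 : ℝ) |z|) s := by
    intro s _
    have := (((hsh f f' h1 s).sub_const (f x)).sub ((hasDerivAt_id s).const_mul (f' x))).sub
      ((((hasDerivAt_id s).mul (hasDerivAt_id s)).const_mul (f'' x)).const_mul (1 / 2))
    refine HasDerivAt.hasDerivWithinAt ?_
    convert this using 1
    · rfl
    · simp only [id_eq]; ring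
  have := hs.norm_image_sub_le_of_norm_hasDerivWithin_le hd (C := M * |z| ^ 2)
    (fun s hs' => g s hs') h0 hz
  simp only [add_zero, sub_self, mul_zero, sub_zero, Real.norm_eq_abs] at this
  refine this.trans (le_of_eq (by ring))

lemma Tay.coord {ι : Type*} [Fintype ι] [DecidableEq ι] {f f' f'' : ℝ → ℝ}
    (h1 : ∀ x, HasDerivAt f (f' x) x)
    (h2 : ∀ x, HasDerivAt f' (f'' x) x) {M : ℝ} (hM : 0 ≤ M)
    (h3 : ∀ x y, |f'' x - f'' y| ≤ M * |x - y|) (b0 : ∀ x, |f x| ≤ M) (b1 : ∀ x, |f' x| ≤ M)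
    (b2 : ∀ x, |f'' x| ≤ M) (i : ι) :
    Tay (fun x : ι → ℝ => f (x i)) (fun x a => if a = i then f' (x i) else 0)
      (fun x a b => if a = i ∧ b = i then f'' (x i) else 0) := by
  have hc : Continuous f := continuous_iff_continuousAt.2 fun x => (h1 x).continuousAt
  refine ⟨hc.comp (continuous_apply i), M, hM, fun x => b0 _, ?_, ?_, ?_⟩
  · intro x a; split_ifs
    · exact b1 _
    · simpa using hM
  · intro x a b; split_ifs
    · exact b2 _
    · simpa using hM
  · intro x z
    have := taylor_one h1 h2 hM h3 (x i) (z i)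
    have e1 : ∑ a, (if a = i then f' (x i) else 0) * z a = f' (x i) * z i := by
      simp [ite_mul]
    have e2 : ∑ a, ∑ b, (if a = i ∧ b = i then f'' (x i) else 0) * (z a * z b)
        = f'' (x i) * (z i * z i) := by
      rw [Finset.sum_eq_single i, Finset.sum_eq_single i]
      · simp
      · intro b _ hb; simp [hb]
      · simp
      · intro a _ ha; simp [ha]
      · simp
    rw [e1, e2]
    refine this.trans ?_
    gcongr
    exact norm_le_pi_norm z i

/-! ### Gaussian comparison -/

def gop {E : Type*} [NormedAddCommGroup E] [NormedSpace ℝ E] [MeasurableSpace E]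
    (μ : Measure E) (s : ℝ) (f : E → ENNReal) (p : E) : ENNReal :=
  ∫⁻ z, f (p + Real.sqrt s • z) ∂μ

section gop
variable {E : Type*} [NormedAddCommGroup E] [NormedSpace ℝ E] [MeasurableSpace E] [BorelSpace E]
  [SecondCountableTopology E]

lemma gop_measurable (μ : Measure E) [SFinite μ] (s : ℝ) {f : E → ENNReal} (hf : Measurable f) :
    Measurable (gop μ s f) := by
  unfold gop
  have : Measurable (fun q : E × E => f (q.1 + Real.sqrt s • q.2)) :=
    hf.comp (by fun_prop)
  exact this.lintegral_prod_right'

lemma gop_mono (μ : Measure E) (s : ℝ) {f g : E → ENNReal} (h : ∀ x, f x ≤ g x) (p : E) :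
    gop μ s f p ≤ gop μ s g p := lintegral_mono fun z => h _

lemma gop_add_const (μ : Measure E) [IsProbabilityMeasure μ] (s : ℝ) {f : E → ENNReal}
    (c : ENNReal) (p : E) : gop μ s (fun x => f x + c) p = gop μ s f p + c := by
  unfold gop
  rw [lintegral_add_right _ measurable_const]
  simp

lemma gop_comm (μ ν : Measure E) [SFinite μ] [SFinite ν] (s t : ℝ) {f : E → ENNReal}
    (hf : Measurable f) (p : E) : gop μ s (gop ν t f) p = gop ν t (gop μ s f) p := by
  unfold gop
  rw [lintegral_lintegral_swap]
  · refine lintegral_congr fun y => lintegral_congr fun x => ?_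
    congr 1; abel
  · exact (hf.comp (by fun_prop : Measurable fun q : E × E =>
      p + Real.sqrt s • q.1 + Real.sqrt t • q.2)).aemeasurable

lemma gop_add [CompleteSpace E] (μ : Measure E) [IsGaussian μ] (hμ : ∫ x, x ∂μ = 0) {s t : ℝ}
    (hs : 0 ≤ s) (ht : 0 < t)
    {f : E → ENNReal} (hf : Measurable f) (p : E) : gop μ s (gop μ t f) p = gop μ (s + t) f p := by
  have hst : 0 < s + t := by linarith
  set θ := Real.arccos (Real.sqrt (s / (s + t)))
  have hq : Real.sqrt (s / (s + t)) ≤ 1 := by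
    rw [Real.sqrt_le_one, div_le_one hst]; linarith
  have hcos : Real.cos θ = Real.sqrt (s / (s + t)) :=
    Real.cos_arccos (by linarith [Real.sqrt_nonneg (s / (s + t))]) hq
  have hsin : Real.sin θ = Real.sqrt (t / (s + t)) := by
    rw [Real.sin_arccos, Real.sq_sqrt (by positivity)]
    congr 1; field_simp; ring
  have hrot := IsGaussian.map_rotation_eq_self (μ := μ) hμ θ
  unfold gop
  rw [← lintegral_prod (fun q : E × E => f (p + Real.sqrt s • q.1 + Real.sqrt t • q.2))]
  swap
  · exact (hf.comp (by fun_prop : Measurable fun q : E × E =>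
      p + Real.sqrt s • q.1 + Real.sqrt t • q.2)).aemeasurable
  have hm : Measurable fun q : E × E => f (p + Real.sqrt (s + t) • q.1) := hf.comp (by fun_prop)
  calc ∫⁻ q, f (p + Real.sqrt s • q.1 + Real.sqrt t • q.2) ∂(μ.prod μ)
      = ∫⁻ q, f (p + Real.sqrt (s + t) • (ContinuousLinearMap.rotation θ q).1) ∂(μ.prod μ) := by
        refine lintegral_congr fun q => ?_
        rw [ContinuousLinearMap.rotation_apply, hcos, hsin]
        simp only [smul_add, smul_smul]
        rw [← Real.sqrt_mul hst.le, ← Real.sqrt_mul hst.le, mul_div_cancel₀ _ hst.ne',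
          mul_div_cancel₀ _ hst.ne', add_assoc]
    _ = ∫⁻ q, f (p + Real.sqrt (s + t) • q.1) ∂((μ.prod μ).map (ContinuousLinearMap.rotation θ)) := by
        rw [lintegral_map hm (by fun_prop)]
    _ = ∫⁻ q, f (p + Real.sqrt (s + t) • q.1) ∂(μ.prod μ) := by rw [hrot]
    _ = ∫⁻ z, f (p + Real.sqrt (s + t) • z) ∂μ := by
        rw [lintegral_prod _ hm.aemeasurable]; simp

lemma gop_iter [CompleteSpace E] (μ ν : Measure E) [IsGaussian μ] [IsGaussian ν]
    (hμ : ∫ x, x ∂μ = 0) (hν : ∫ x, x ∂ν = 0) {f : E → ENNReal} (hf : Measurable f)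
    {h : ℝ} (hh : 0 < h) (c : ENNReal) (hc : ∀ p, gop ν h f p ≤ gop μ h f p + c) (k : ℕ) (p : E) :
    gop ν ((k : ℝ) * h) f p ≤ gop μ ((k : ℝ) * h) f p + k * c := by
  induction k generalizing p with
  | zero => simp [gop]
  | succ k ih =>
    have e : ((k + 1 : ℕ) : ℝ) * h = (k : ℝ) * h + h := by push_cast; ring
    have hk : (0 : ℝ) ≤ k * h := by positivity
    rw [e, ← gop_add ν hν hk hh hf, ← gop_add μ hμ hk hh hf]
    calc gop ν (k * h) (gop ν h f) p ≤ gop ν (k * h) (fun x => gop μ h f x + c) p :=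
          gop_mono _ _ hc p
      _ = gop μ h (gop ν (k * h) f) p + c := by rw [gop_add_const, gop_comm _ _ _ _ hf]
      _ ≤ gop μ h (fun x => gop μ (k * h) f x + k * c) p + c := by
          gcongr; exact gop_mono _ _ ih p
      _ = _ := by
          rw [gop_add_const, gop_comm _ _ _ _ hf]; push_cast; ring

end gop

/-- one-step expansion -/
lemma tay_step {ι : Type*} [Fintype ι] {F : (ι → ℝ) → ℝ} {G : (ι → ℝ) → ι → ℝ}
    {H : (ι → ℝ) → ι → ι → ℝ} (hF : Tay F G H) (μ : Measure (ι → ℝ)) [IsGaussian μ]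
    (hμ : ∫ x, x ∂μ = 0) :
    ∃ C : ℝ, 0 ≤ C ∧ ∀ (p : ι → ℝ) (r : ℝ), 0 ≤ r →
      Integrable (fun z => F (p + r • z)) μ ∧
      |∫ z, F (p + r • z) ∂μ - F p - r ^ 2 * (1 / 2) * ∑ a, ∑ b, H p a b * ∫ z, z a * z b ∂μ|
        ≤ C * r ^ 3 := by
  obtain ⟨C, hC, hb, -, -, hT⟩ := hF.bound
  have hid : MemLp id 3 μ := IsGaussian.memLp_id μ 3 (by norm_num)
  have h3 : Integrable (fun z : ι → ℝ => ‖z‖ ^ 3) μ := by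
    have := hid.integrable_norm_pow (p := 3) (by norm_num)
    simpa using this
  have hid2 : MemLp id 2 μ := IsGaussian.memLp_two_id
  have hco : ∀ a, MemLp (fun z : ι → ℝ => z a) 2 μ := fun a => by
    refine hid2.of_le (measurable_pi_apply a).aestronglyMeasurable (Filter.Eventually.of_forall fun z => norm_le_pi_norm z a)
  have hco1 : ∀ a, Integrable (fun z : ι → ℝ => z a) μ := fun a =>
    (hco a).integrable (by norm_num)
  have hpr : ∀ a b, Integrable (fun z : ι → ℝ => z a * z b) μ := fun a b =>
    (hco a).integrable_mul (hco b)
  have hm0 : ∀ a, ∫ z, z a ∂μ = 0 := fun a => by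
    have := eval_integral (μ := μ) (f := fun z : ι → ℝ => z) hco1 a
    rw [hμ] at this; simpa using this.symm
  refine ⟨C * ∫ z, ‖z‖ ^ 3 ∂μ, by positivity, fun p r hr => ?_⟩
  have hFi : Integrable (fun z => F (p + r • z)) μ := by
    refine Integrable.of_bound (C := C) ?_ (Filter.Eventually.of_forall fun z => hb _)
    exact (hF.cont.comp (by fun_prop : Continuous fun z : ι → ℝ => p + r • z)).aestronglyMeasurable
  refine ⟨hFi, ?_⟩
  have iL : Integrable (fun z : ι → ℝ => ∑ a, G p a * (r • z) a) μ :=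
    integrable_finsetSum _ fun a _ => ((hco1 a).const_mul r).const_mul _
  have iQ : Integrable (fun z : ι → ℝ => (1 / 2) * ∑ a, ∑ b, H p a b * ((r • z) a * (r • z) b)) μ := by
    refine Integrable.const_mul (integrable_finsetSum _ fun a _ => integrable_finsetSum _
      fun b _ => ?_) _
    refine Integrable.const_mul ?_ _
    have := (hpr a b).const_mul (r ^ 2)
    refine this.congr (Filter.Eventually.of_forall fun z => ?_)
    simp; ring
  have vL : ∫ z, ∑ a, G p a * (r • z) a ∂μ = 0 := by
    simp only [Pi.smul_apply, smul_eq_mul]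
    rw [integral_finsetSum _ fun a _ => ((hco1 a).const_mul r).const_mul _]
    refine Finset.sum_eq_zero fun a _ => ?_
    rw [integral_const_mul, integral_const_mul, hm0]; simp
  have vQ : ∫ z, (1 / 2) * ∑ a, ∑ b, H p a b * ((r • z) a * (r • z) b) ∂μ
      = r ^ 2 * (1 / 2) * ∑ a, ∑ b, H p a b * ∫ z, z a * z b ∂μ := by
    have e : ∀ z : ι → ℝ, (1 / 2) * ∑ a, ∑ b, H p a b * ((r • z) a * (r • z) b)
        = r ^ 2 * (1 / 2) * ∑ a, ∑ b, H p a b * (z a * z b) := by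
      intro z
      simp only [Finset.mul_sum, Pi.smul_apply, smul_eq_mul]
      refine Finset.sum_congr rfl fun a _ => Finset.sum_congr rfl fun b _ => by ring
    simp_rw [e]
    rw [integral_const_mul, integral_finsetSum _ fun a _ => integrable_finsetSum _
      fun b _ => (hpr a b).const_mul _]
    congr 1
    refine Finset.sum_congr rfl fun a _ => ?_
    rw [integral_finsetSum _ fun b _ => (hpr a b).const_mul _]
    refine Finset.sum_congr rfl fun b _ => ?_
    rw [integral_const_mul]
  have key : ∫ z, F (p + r • z) ∂μ - F p - r ^ 2 * (1 / 2) * ∑ a, ∑ b, H p a b * ∫ z, z a * z b ∂μ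
      = ∫ z, (F (p + r • z) - F p - ∑ a, G p a * (r • z) a
          - (1 / 2) * ∑ a, ∑ b, H p a b * ((r • z) a * (r • z) b)) ∂μ := by
    have i1 : Integrable (fun z => F (p + r • z) - F p) μ := hFi.sub (integrable_const _)
    have i2 : Integrable (fun z => F (p + r • z) - F p - ∑ a, G p a * (r • z) a) μ := i1.sub iL
    rw [integral_sub i2 iQ, integral_sub i1 iL, integral_sub hFi (integrable_const _), vL, vQ]
    simp
  rw [key]
  refine (abs_integral_le_integral_abs).trans ?_
  calc _ ≤ ∫ z, C * r ^ 3 * ‖z‖ ^ 3 ∂μ := by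
        refine integral_mono_of_nonneg (Filter.Eventually.of_forall fun _ => abs_nonneg _)
          (h3.const_mul _) (Filter.Eventually.of_forall fun z => ?_)
        refine (hT p (r • z)).trans (le_of_eq ?_)
        rw [norm_smul, Real.norm_of_nonneg hr]; ring
    _ = _ := by rw [integral_const_mul]; ring

/-- Slepian–Gordon comparison of smooth functionals. -/
lemma gauss_compare {ι : Type*} [Fintype ι] {F : (ι → ℝ) → ℝ} {G : (ι → ℝ) → ι → ℝ}
    {H : (ι → ℝ) → ι → ι → ℝ} (hF : Tay F G H) (hF0 : ∀ x, 0 ≤ F x)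
    (μ ν : Measure (ι → ℝ)) [IsGaussian μ] [IsGaussian ν]
    (hμ : ∫ x, x ∂μ = 0) (hν : ∫ x, x ∂ν = 0)
    (hcmp : ∀ x a b, H x a b * ∫ z, z a * z b ∂ν ≤ H x a b * ∫ z, z a * z b ∂μ) :
    ∫⁻ x, ENNReal.ofReal (F x) ∂ν ≤ ∫⁻ x, ENNReal.ofReal (F x) ∂μ := by
  obtain ⟨C, hC, h1⟩ := tay_step hF μ hμ
  obtain ⟨C', hC', h2⟩ := tay_step hF ν hν
  set f : (ι → ℝ) → ENNReal := fun x => ENNReal.ofReal (F x)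
  have hf : Measurable f := hF.cont.measurable.ennreal_ofReal
  have step : ∀ (h : ℝ), 0 < h → ∀ p, gop ν h f p ≤ gop μ h f p
      + ENNReal.ofReal ((C + C') * Real.sqrt h ^ 3) := by
    intro h hh p
    obtain ⟨i1, b1⟩ := h1 p (Real.sqrt h) (Real.sqrt_nonneg _)
    obtain ⟨i2, b2⟩ := h2 p (Real.sqrt h) (Real.sqrt_nonneg _)
    have e1 : gop μ h f p = ENNReal.ofReal (∫ z, F (p + Real.sqrt h • z) ∂μ) := by
      rw [ofReal_integral_eq_lintegral_ofReal i1 (Filter.Eventually.of_forall fun _ => hF0 _)]; rfl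
    have e2 : gop ν h f p = ENNReal.ofReal (∫ z, F (p + Real.sqrt h • z) ∂ν) := by
      rw [ofReal_integral_eq_lintegral_ofReal i2 (Filter.Eventually.of_forall fun _ => hF0 _)]; rfl
    rw [e1, e2, ← ENNReal.ofReal_add (integral_nonneg fun _ => hF0 _) (by positivity)]
    apply ENNReal.ofReal_le_ofReal
    have hs : ∑ a, ∑ b, H p a b * ∫ z, z a * z b ∂ν ≤ ∑ a, ∑ b, H p a b * ∫ z, z a * z b ∂μ :=
      Finset.sum_le_sum fun a _ => Finset.sum_le_sum fun b _ => hcmp p a b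
    have hs' := mul_le_mul_of_nonneg_left hs (by positivity : 0 ≤ Real.sqrt h ^ 2 * (1 / 2))
    rw [abs_le] at b1 b2
    linarith
  have main : ∀ N : ℕ, 0 < N → gop ν 1 f 0 ≤ gop μ 1 f 0
      + ENNReal.ofReal ((C + C') * Real.sqrt (1 / N)) := by
    intro N hN
    have hN' : (0 : ℝ) < N := Nat.cast_pos.2 hN
    have := gop_iter μ ν hμ hν hf (h := 1 / N) (by positivity) _ (step _ (by positivity)) N 0
    rw [mul_one_div_cancel hN'.ne'] at this
    refine this.trans (le_of_eq ?_)
    congr 1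
    rw [← ENNReal.ofReal_natCast, ← ENNReal.ofReal_mul hN'.le]
    congr 1
    have : Real.sqrt (1 / N) ^ 3 = (1 / N) * Real.sqrt (1 / N) := by
      rw [pow_succ, Real.sq_sqrt (by positivity)]
    rw [this]; field_simp
  have e : ∀ m : Measure (ι → ℝ), gop m 1 f 0 = ∫⁻ x, f x ∂m := by
    intro m; simp [gop]
  rw [e, e] at main
  have lim : Filter.Tendsto (fun N : ℕ => ∫⁻ x, f x ∂μ
      + ENNReal.ofReal ((C + C') * Real.sqrt (1 / N))) Filter.atTop
      (nhds (∫⁻ x, f x ∂μ + 0)) := by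
    refine Filter.Tendsto.const_add _ ?_
    have : Filter.Tendsto (fun N : ℕ => (C + C') * Real.sqrt (1 / N)) Filter.atTop (nhds 0) := by
      have h := (Real.continuous_sqrt.tendsto 0).comp (tendsto_one_div_atTop_nhds_zero_nat (𝕜 := ℝ))
      rw [Real.sqrt_zero] at h
      simpa using h.const_mul (C + C')
    simpa using ENNReal.tendsto_ofReal this
  rw [add_zero] at lim
  refine ge_of_tendsto lim ?_
  filter_upwards [Filter.eventually_gt_atTop 0] with N hN using main N hN

/-! ### Gordon's inequality for finite families -/

lemma exists_step (l η : ℝ) (hη : 0 < η) : ∃ (f f' f'' : ℝ → ℝ) (M : ℝ), 0 ≤ M ∧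
    (∀ x, HasDerivAt f (f' x) x) ∧ (∀ x, HasDerivAt f' (f'' x) x) ∧
    (∀ x y, |f'' x - f'' y| ≤ M * |x - y|) ∧ (∀ x, |f x| ≤ M) ∧ (∀ x, |f' x| ≤ M) ∧
    (∀ x, |f'' x| ≤ M) ∧ (∀ x, 0 ≤ f x ∧ f x ≤ 1) ∧ (∀ x, 0 ≤ f' x) ∧ (∀ x, x ≤ l → f x = 0) ∧
    (∀ x, l + η ≤ x → f x = 1) := by
  set f : ℝ → ℝ := fun x => Real.smoothTransition ((x - l) / η) with hf
  have hc : ContDiff ℝ 3 f := by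
    have : ContDiff ℝ 3 Real.smoothTransition := Real.smoothTransition.contDiff (n := 3)
    exact this.comp (by fun_prop)
  have hmono : Monotone f := fun x y hxy => Real.smoothTransition.monotone (by
    have : 0 ≤ η := hη.le
    gcongr)
  have c1 : ContDiff ℝ 2 (deriv f) := by
    have h : ContDiff ℝ (2 + 1) f := by exact_mod_cast hc
    exact (contDiff_succ_iff_deriv.1 h).2.2
  have c2 : ContDiff ℝ 1 (deriv (deriv f)) := by
    have h : ContDiff ℝ (1 + 1) (deriv f) := by exact_mod_cast c1
    exact (contDiff_succ_iff_deriv.1 h).2.2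
  have c3 : Continuous (deriv (deriv (deriv f))) := c2.continuous_deriv (by norm_num)
  have s1 : HasCompactSupport (deriv f) := by
    refine HasCompactSupport.intro (isCompact_Icc (a := l) (b := l + η)) fun x hx => ?_
    rw [Set.mem_Icc, not_and_or, not_le, not_le] at hx
    rcases hx with hx | hx
    · have : f =ᶠ[nhds x] fun _ => 0 := by
        filter_upwards [eventually_lt_nhds hx] with y hy
        exact Real.smoothTransition.zero_of_nonpos (div_nonpos_of_nonpos_of_nonneg (by linarith) hη.le)
      rw [this.deriv_eq]; simp
    · have : f =ᶠ[nhds x] fun _ => 1 := by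
        filter_upwards [eventually_gt_nhds hx] with y hy
        exact Real.smoothTransition.one_of_one_le ((one_le_div hη).2 (by linarith))
      rw [this.deriv_eq]; simp
  have s2 := s1.deriv
  have s3 := s2.deriv
  obtain ⟨C1, h1⟩ := c1.continuous.bounded_above_of_compact_support s1
  obtain ⟨C2, h2⟩ := c2.continuous.bounded_above_of_compact_support s2
  obtain ⟨C3, h3⟩ := c3.bounded_above_of_compact_support s3
  have p1 : 0 ≤ C1 := (norm_nonneg _).trans (h1 0)
  have p2 : 0 ≤ C2 := (norm_nonneg _).trans (h2 0)
  have p3 : 0 ≤ C3 := (norm_nonneg _).trans (h3 0)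
  refine ⟨f, deriv f, deriv (deriv f), 1 + C1 + C2 + C3, by positivity,
    fun x => (hc.differentiable (by norm_num) x).hasDerivAt,
    fun x => (c1.differentiable (by norm_num) x).hasDerivAt, fun x y => ?_, fun x => ?_, fun x => ?_,
    fun x => ?_, fun x => ⟨Real.smoothTransition.nonneg _, Real.smoothTransition.le_one _⟩,
    fun x => hmono.deriv_nonneg, fun x hx => ?_, fun x hx => ?_⟩
  · have := convex_univ.norm_image_sub_le_of_norm_deriv_le (f := deriv (deriv f)) (s := Set.univ)
      (C := C3) (fun x _ => c2.differentiable (by norm_num) x) (fun x _ => h3 x)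
      (Set.mem_univ y) (Set.mem_univ x)
    simp only [Real.norm_eq_abs] at this
    refine this.trans ?_
    gcongr; linarith
  · rw [abs_of_nonneg (Real.smoothTransition.nonneg _)]
    exact (Real.smoothTransition.le_one _).trans (by linarith)
  · exact (h1 x).trans (by linarith)
  · exact (h2 x).trans (by linarith)
  · exact Real.smoothTransition.zero_of_nonpos (div_nonpos_of_nonpos_of_nonneg (by linarith) hη.le)
  · exact Real.smoothTransition.one_of_one_le ((one_le_div hη).2 (by linarith))

def ClsA {I J : Type*} [Fintype I] [Fintype J] (i : I) (F : (I × J → ℝ) → ℝ) : Prop :=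
  ∃ G H, Tay F G H ∧ (∀ x, 0 ≤ F x ∧ F x ≤ 1) ∧ (∀ x a, G x a ≤ 0) ∧
    (∀ x a, a.1 ≠ i → G x a = 0) ∧ (∀ x a b, a.1 ≠ b.1 → H x a b = 0)

def ClsB {I J : Type*} [Fintype I] [Fintype J] (F : (I × J → ℝ) → ℝ) : Prop :=
  ∃ G H, Tay F G H ∧ (∀ x, 0 ≤ F x ∧ F x ≤ 1) ∧ (∀ x a, 0 ≤ G x a) ∧
    (∀ x a b, a.1 ≠ b.1 → 0 ≤ H x a b)

lemma ClsA.prod {I J κ : Type*} [Fintype I] [Fintype J] (i : I) (s : Finset κ)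
    (f : κ → (I × J → ℝ) → ℝ) (hf : ∀ j ∈ s, ClsA i (f j)) : ClsA i (fun x => ∏ j ∈ s, f j x) := by
  classical
  induction s using Finset.induction_on with
  | empty =>
    simp only [Finset.prod_empty]
    exact ⟨_, _, Tay.const 1, by simp, by simp, by simp, by simp⟩
  | insert a s ha ih =>
    simp only [Finset.prod_insert ha]
    obtain ⟨G₁, H₁, t1, b1, g1, z1, k1⟩ := hf a (Finset.mem_insert_self _ _)
    obtain ⟨G₂, H₂, t2, b2, g2, z2, k2⟩ := ih fun j hj => hf j (Finset.mem_insert_of_mem hj)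
    refine ⟨_, _, t1.mul t2, fun x => ⟨mul_nonneg (b1 x).1 (b2 x).1,
      mul_le_one₀ (b1 x).2 (b2 x).1 (b2 x).2⟩, fun x a => ?_, fun x a h => ?_, fun x a b h => ?_⟩
    · have := mul_nonneg (b1 x).1 (neg_nonneg.2 (g2 x a))
      have := mul_nonneg (b2 x).1 (neg_nonneg.2 (g1 x a))
      linarith
    · simp only [z1 x a h, z2 x a h]; simp
    · simp only [k1 x a b h, k2 x a b h]
      by_cases hi : a.1 = i
      · have hb : b.1 ≠ i := fun hb => h (hi.trans hb.symm)
        rw [z1 x b hb, z2 x b hb]; simp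
      · rw [z1 x a hi, z2 x a hi]; simp

lemma ClsB.prod {I J κ : Type*} [Fintype I] [Fintype J] (s : Finset κ)
    (f : κ → (I × J → ℝ) → ℝ) (hf : ∀ j ∈ s, ClsB (f j)) : ClsB (fun x => ∏ j ∈ s, f j x) := by
  classical
  induction s using Finset.induction_on with
  | empty =>
    simp only [Finset.prod_empty]
    exact ⟨_, _, Tay.const 1, by simp, by simp, by simp⟩
  | insert a s ha ih =>
    simp only [Finset.prod_insert ha]
    obtain ⟨G₁, H₁, t1, b1, g1, k1⟩ := hf a (Finset.mem_insert_self _ _)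
    obtain ⟨G₂, H₂, t2, b2, g2, k2⟩ := ih fun j hj => hf j (Finset.mem_insert_of_mem hj)
    refine ⟨_, _, t1.mul t2, fun x => ⟨mul_nonneg (b1 x).1 (b2 x).1,
      mul_le_one₀ (b1 x).2 (b2 x).1 (b2 x).2⟩, fun x a => ?_, fun x a b h => ?_⟩
    · have := mul_nonneg (b1 x).1 (g2 x a)
      have := mul_nonneg (b2 x).1 (g1 x a)
      linarith
    · have := mul_nonneg (b1 x).1 (k2 x a b h)
      have := mul_nonneg (b2 x).1 (k1 x a b h)
      have := mul_nonneg (g1 x a) (g2 x b)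
      have := mul_nonneg (g2 x a) (g1 x b)
      linarith

lemma gordon_finite {I J : Type*} [Fintype I] [Fintype J] (μ ν : Measure (I × J → ℝ))
    [IsGaussian μ] [IsGaussian ν] (hμ : ∫ x, x ∂μ = 0) (hν : ∫ x, x ∂ν = 0)
    (hsame : ∀ a b : I × J, a.1 = b.1 → ∫ z, z a * z b ∂ν = ∫ z, z a * z b ∂μ)
    (hdiff : ∀ a b : I × J, a.1 ≠ b.1 → ∫ z, z a * z b ∂ν ≤ ∫ z, z a * z b ∂μ)
    (l : I × J → ℝ) {η : ℝ} (hη : 0 < η) :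
    ν {x | ∀ i, ∃ j, l (i, j) + η ≤ x (i, j)} ≤ μ {x | ∀ i, ∃ j, l (i, j) < x (i, j)} := by
  classical
  choose f f' f'' M hM d1 d2 hL b0 b1 b2 h01 hpos hz ho using fun a => exists_step (l a) η hη
  have hA : ∀ i j, ClsA i (fun x : I × J → ℝ => 1 - f (i, j) (x (i, j))) := by
    intro i j
    refine ⟨_, _, (Tay.coord (d1 (i, j)) (d2 (i, j)) (hM (i, j)) (hL _) (b0 _) (b1 _) (b2 _)
      (i, j)).one_sub, fun x => ?_, fun x a => ?_, fun x a h => ?_, fun x a b h => ?_⟩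
    · have := h01 (i, j) (x (i, j)); constructor <;> linarith
    · have := hpos (i, j) (x (i, j))
      split_ifs <;> simp [this]
    · have : a ≠ (i, j) := fun e => h (by rw [e])
      simp [this]
    · have : ¬ (a = (i, j) ∧ b = (i, j)) := fun e => h (by rw [e.1, e.2])
      simp [this]
  have hB : ∀ i, ClsB (fun x : I × J → ℝ => 1 - ∏ j, (1 - f (i, j) (x (i, j)))) := by
    intro i
    obtain ⟨G, H, t, b, g, z, k⟩ := ClsA.prod i Finset.univ _ (fun j _ => hA i j)
    refine ⟨_, _, t.one_sub, fun x => ?_, fun x a => ?_, fun x a b h => ?_⟩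
    · have := b x; constructor <;> linarith
    · have := g x a; linarith
    · simp [k x a b h]
  obtain ⟨G, H, t, b, g, k⟩ := ClsB.prod Finset.univ _ (fun i _ => hB i)
  have hcmp := gauss_compare t (fun x => (b x).1) μ ν hμ hν (fun x a b => by
    by_cases h : a.1 = b.1
    · rw [hsame a b h]
    · exact mul_le_mul_of_nonneg_left (hdiff a b h) (k x a b h))
  have mA : MeasurableSet {x : I × J → ℝ | ∀ i, ∃ j, l (i, j) + η ≤ x (i, j)} := by
    have : {x : I × J → ℝ | ∀ i, ∃ j, l (i, j) + η ≤ x (i, j)}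
        = ⋂ i, ⋃ j, {x : I × J → ℝ | l (i, j) + η ≤ x (i, j)} := by ext; simp
    rw [this]
    refine MeasurableSet.iInter fun i => MeasurableSet.iUnion fun j => ?_
    exact measurableSet_le measurable_const (measurable_pi_apply _)
  have mB : MeasurableSet {x : I × J → ℝ | ∀ i, ∃ j, l (i, j) < x (i, j)} := by
    have : {x : I × J → ℝ | ∀ i, ∃ j, l (i, j) < x (i, j)}
        = ⋂ i, ⋃ j, {x : I × J → ℝ | l (i, j) < x (i, j)} := by ext; simp
    rw [this]
    refine MeasurableSet.iInter fun i => MeasurableSet.iUnion fun j => ?_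
    exact measurableSet_lt measurable_const (measurable_pi_apply _)
  rw [← lintegral_indicator_one mA, ← lintegral_indicator_one mB]
  refine le_trans (lintegral_mono fun x => ?_) (hcmp.trans (lintegral_mono fun x => ?_))
  · by_cases hx : x ∈ {x : I × J → ℝ | ∀ i, ∃ j, l (i, j) + η ≤ x (i, j)}
    · rw [Set.indicator_of_mem hx]
      have : ∏ i, (1 - ∏ j, (1 - f (i, j) (x (i, j)))) = 1 := by
        refine Finset.prod_eq_one fun i _ => ?_
        obtain ⟨j, hj⟩ := hx i
        rw [Finset.prod_eq_zero (Finset.mem_univ j)]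
        · simp
        · rw [ho _ _ hj]; simp
      rw [this]; simp
    · rw [Set.indicator_of_notMem hx]; exact zero_le
  · by_cases hx : x ∈ {x : I × J → ℝ | ∀ i, ∃ j, l (i, j) < x (i, j)}
    · rw [Set.indicator_of_mem hx]
      simpa using (b x).2
    · rw [Set.indicator_of_notMem hx]
      simp only [Set.mem_setOf_eq, not_forall, not_exists, not_lt] at hx
      obtain ⟨i, hi⟩ := hx
      have : ∏ i, (1 - ∏ j, (1 - f (i, j) (x (i, j)))) = 0 := by
        refine Finset.prod_eq_zero (Finset.mem_univ i) ?_
        rw [Finset.prod_eq_one]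
        · simp
        · intro j _; rw [hz _ _ (hi j)]; simp
      rw [this]; simp

/-! ### Gordon's inequality for the Gaussian matrix process -/

def matCLM {n d : ℕ} (v : Fin n → ℝ) (u : Fin d → ℝ) : (Fin n → Fin d → ℝ) →L[ℝ] ℝ :=
  ∑ i, v i • (dotCLM u).comp (ContinuousLinearMap.proj i)

lemma matCLM_apply {n d : ℕ} (v : Fin n → ℝ) (u : Fin d → ℝ) (X : Fin n → Fin d → ℝ) :
    matCLM v u X = v ⬝ᵥ fun i => u ⬝ᵥ X i := by
  simp [matCLM, dotCLM_apply, dotProduct]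

lemma muX_integral_id (n d : ℕ) : ∫ X, X ∂(μX n d) = 0 := by
  have hi : ∀ i : Fin n, Integrable (fun X : Fin n → Fin d → ℝ => X i) (μX n d) := fun i =>
    ((measurePreserving_eval (fun _ : Fin n => gaussPi d) i).integrable_comp
      aestronglyMeasurable_id).2 (IsGaussian.integrable_id (μ := gaussPi d))
  ext1 i
  rw [eval_integral hi]
  have mp := measurePreserving_eval (fun _ : Fin n => gaussPi d) i
  have h1 := integral_map (μ := μX n d) (φ := fun X : Fin n → Fin d → ℝ => X i)
      mp.measurable.aemeasurable (f := fun g : Fin d → ℝ => g) (by fun_prop)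
  rw [← h1]
  have h2 : Measure.map (fun X : Fin n → Fin d → ℝ => X i) (μX n d) = gaussPi d := mp.map_eq
  rw [h2, gaussPi_integral_id]; rfl

lemma prod_second_moment {E E' : Type*} [MeasurableSpace E] [MeasurableSpace E']
    (μ : Measure E) (ν : Measure E') [IsProbabilityMeasure μ] [IsProbabilityMeasure ν]
    {f f' : E → ℝ} {g g' : E' → ℝ} (hf : MemLp f 2 μ) (hf' : MemLp f' 2 μ) (hg : MemLp g 2 ν)
    (hg' : MemLp g' 2 ν) (f0 : ∫ x, f x ∂μ = 0) (f0' : ∫ x, f' x ∂μ = 0) :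
    ∫ q, (f q.1 + g q.2) * (f' q.1 + g' q.2) ∂(μ.prod ν)
      = ∫ x, f x * f' x ∂μ + ∫ y, g y * g' y ∂ν := by
  have i1 : Integrable (fun q : E × E' => (f q.1 * f' q.1) * 1) (μ.prod ν) :=
    (hf.integrable_mul hf').mul_prod (integrable_const 1)
  have i2 : Integrable (fun q : E × E' => f q.1 * g' q.2) (μ.prod ν) :=
    (hf.integrable (by norm_num)).mul_prod (hg'.integrable (by norm_num))
  have i3 : Integrable (fun q : E × E' => f' q.1 * g q.2) (μ.prod ν) :=
    (hf'.integrable (by norm_num)).mul_prod (hg.integrable (by norm_num))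
  have i4 : Integrable (fun q : E × E' => 1 * (g q.2 * g' q.2)) (μ.prod ν) :=
    (integrable_const 1).mul_prod (hg.integrable_mul hg')
  have e : ∀ q : E × E', (f q.1 + g q.2) * (f' q.1 + g' q.2)
      = ((f q.1 * f' q.1) * 1 + f q.1 * g' q.2) + (f' q.1 * g q.2 + 1 * (g q.2 * g' q.2)) := by
    intro q; ring
  simp_rw [e]
  have j1 : Integrable (fun q : E × E' => (f q.1 * f' q.1) * 1 + f q.1 * g' q.2) (μ.prod ν) :=
    i1.add i2
  have j2 : Integrable (fun q : E × E' => f' q.1 * g q.2 + 1 * (g q.2 * g' q.2)) (μ.prod ν) :=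
    i3.add i4
  rw [integral_add j1 j2, integral_add i1 i2, integral_add i3 i4,
    integral_prod_mul (fun x => f x * f' x) (fun _ => (1 : ℝ)), integral_prod_mul f g',
    integral_prod_mul f' g, integral_prod_mul (fun _ => (1 : ℝ)) (fun y => g y * g' y), f0, f0']
  simp

lemma pi_cov_map {E ι : Type*} [NormedAddCommGroup E] [NormedSpace ℝ E] [MeasurableSpace E]
    [BorelSpace E] [Fintype ι] (μ : Measure E) (L : E →L[ℝ] (ι → ℝ)) (a b : ι) :
    ∫ z, z a * z b ∂(μ.map L) = ∫ x, L x a * L x b ∂μ := by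
  rw [integral_map (by fun_prop)]
  exact ((measurable_pi_apply a).mul (measurable_pi_apply b)).aestronglyMeasurable

lemma mean_map {E ι : Type*} [NormedAddCommGroup E] [NormedSpace ℝ E] [MeasurableSpace E]
    [BorelSpace E] [CompleteSpace E] [SecondCountableTopology E] [Fintype ι] (μ : Measure E)
    [IsGaussian μ]
    (h0 : ∫ x, x ∂μ = 0) (L : E →L[ℝ] (ι → ℝ)) : ∫ z, z ∂(μ.map L) = 0 := by
  rw [integral_map (by fun_prop) (by fun_prop)]
  have := L.integral_comp_comm (μ := μ) (φ := fun x => x) IsGaussian.integrable_id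
  rw [this, h0, map_zero]

lemma prod_mean {E E' : Type*} [NormedAddCommGroup E] [NormedSpace ℝ E] [MeasurableSpace E]
    [BorelSpace E] [CompleteSpace E] [SecondCountableTopology E]
    [NormedAddCommGroup E'] [NormedSpace ℝ E'] [MeasurableSpace E']
    [BorelSpace E'] [CompleteSpace E'] [SecondCountableTopology E']
    (μ : Measure E) (ν : Measure E') [IsGaussian μ] [IsGaussian ν] (h : ∫ x, x ∂μ = 0)
    (h' : ∫ x, x ∂ν = 0) : ∫ q, q ∂(μ.prod ν) = 0 := by
  have i1 : Integrable (fun q : E × E' => q.1) (μ.prod ν) :=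
    (measurePreserving_fst.integrable_comp aestronglyMeasurable_id).2
      (IsGaussian.integrable_id (μ := μ))
  have i2 : Integrable (fun q : E × E' => q.2) (μ.prod ν) :=
    (measurePreserving_snd.integrable_comp aestronglyMeasurable_id).2
      (IsGaussian.integrable_id (μ := ν))
  have := integral_pair i1 i2
  simp only [Prod.mk.eta] at this
  rw [this]
  have e1 : ∫ q : E × E', q.1 ∂(μ.prod ν) = 0 := by
    rw [integral_fun_fst (fun x : E => x)]; simp [h]
  have e2 : ∫ q : E × E', q.2 ∂(μ.prod ν) = 0 := by
    rw [integral_fun_snd (fun x : E' => x)]; simp [h']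
  rw [e1, e2]; rfl

lemma memLp_clm {E : Type*} [NormedAddCommGroup E] [NormedSpace ℝ E] [MeasurableSpace E]
    [BorelSpace E] [CompleteSpace E] [SecondCountableTopology E] (μ : Measure E) [IsGaussian μ]
    (L : E →L[ℝ] ℝ) : MemLp (fun x => L x) 2 μ :=
  IsGaussian.memLp_dual μ L 2 (by norm_num)

lemma mean_clm {E : Type*} [NormedAddCommGroup E] [NormedSpace ℝ E] [MeasurableSpace E]
    [BorelSpace E] [CompleteSpace E] [SecondCountableTopology E] (μ : Measure E) [IsGaussian μ]
    (h0 : ∫ x, x ∂μ = 0) (L : E →L[ℝ] ℝ) : ∫ x, L x ∂μ = 0 := by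
  have := L.integral_comp_comm (μ := μ) (φ := fun x => x) IsGaussian.integrable_id
  rw [this, h0, map_zero]

lemma gordon_proc_finite {n d : ℕ} {I J : Type*} [Fintype I] [Fintype J] (u : I → Fin d → ℝ)
    (v : J → Fin n → ℝ) (hv : ∀ j, l2 (v j) = 1) (l : I × J → ℝ) {η : ℝ} (hη : 0 < η) :
    ((gaussPi n).prod (gaussPi d))
      {q | ∀ i, ∃ j, l (i, j) + η ≤ l2 (u i) * (v j ⬝ᵥ q.1) + u i ⬝ᵥ q.2}
    ≤ ((μX n d).prod (gaussianReal 0 1))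
      {q | ∀ i, ∃ j, l (i, j) < (v j ⬝ᵥ fun r => u i ⬝ᵥ q.1 r) + q.2 * l2 (u i)} := by
  set A : ((Fin n → Fin d → ℝ) × ℝ) →L[ℝ] (I × J → ℝ) :=
    ContinuousLinearMap.pi fun a => (matCLM (v a.2) (u a.1)).comp (ContinuousLinearMap.fst ℝ _ _)
      + l2 (u a.1) • ContinuousLinearMap.snd ℝ _ _ with hA
  set B : ((Fin n → ℝ) × (Fin d → ℝ)) →L[ℝ] (I × J → ℝ) :=
    ContinuousLinearMap.pi fun a => (l2 (u a.1) • dotCLM (v a.2)).comp (ContinuousLinearMap.fst ℝ _ _)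
      + (dotCLM (u a.1)).comp (ContinuousLinearMap.snd ℝ _ _) with hB
  have Aa : ∀ q a, A q a = matCLM (v a.2) (u a.1) q.1 + (l2 (u a.1) • ContinuousLinearMap.id ℝ ℝ) q.2 :=
    fun q a => by simp [hA]
  have Ba : ∀ q a, B q a = (l2 (u a.1) • dotCLM (v a.2)) q.1 + dotCLM (u a.1) q.2 :=
    fun q a => by simp [hB]
  have g0 : ∫ x, x ∂(gaussianReal 0 1) = 0 := integral_id_gaussianReal
  have mA := mean_map _ (prod_mean (μX n d) (gaussianReal 0 1) (muX_integral_id n d) g0) A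
  have mB := mean_map _ (prod_mean (gaussPi n) (gaussPi d) (gaussPi_integral_id n)
    (gaussPi_integral_id d)) B
  have cA : ∀ a b, ∫ z, z a * z b ∂(((μX n d).prod (gaussianReal 0 1)).map A)
      = (v a.2 ⬝ᵥ v b.2) * (u a.1 ⬝ᵥ u b.1) + l2 (u a.1) * l2 (u b.1) := by
    intro a b
    rw [pi_cov_map]
    simp_rw [Aa]
    rw [prod_second_moment _ _ (memLp_clm _ _) (memLp_clm _ _) (memLp_clm _ _) (memLp_clm _ _)
      (mean_clm _ (muX_integral_id n d) _) (mean_clm _ (muX_integral_id n d) _)]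
    congr 1
    · simp_rw [matCLM_apply]; exact muX_cov _ _ _ _
    · simp only [ContinuousLinearMap.smul_apply, ContinuousLinearMap.id_apply, smul_eq_mul]
      have : ∀ y : ℝ, l2 (u a.1) * y * (l2 (u b.1) * y) = (l2 (u a.1) * l2 (u b.1)) * (y * y) :=
        fun y => by ring
      simp_rw [this]
      rw [integral_const_mul, integral_sq_gauss, mul_one]
  have cB : ∀ a b, ∫ z, z a * z b ∂(((gaussPi n).prod (gaussPi d)).map B)
      = l2 (u a.1) * l2 (u b.1) * (v a.2 ⬝ᵥ v b.2) + (u a.1 ⬝ᵥ u b.1) := by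
    intro a b
    rw [pi_cov_map]
    simp_rw [Ba]
    rw [prod_second_moment _ _ (memLp_clm _ _) (memLp_clm _ _) (memLp_clm _ _) (memLp_clm _ _)
      (mean_clm _ (gaussPi_integral_id n) _) (mean_clm _ (gaussPi_integral_id n) _)]
    congr 1
    · simp only [ContinuousLinearMap.smul_apply, smul_eq_mul, dotCLM_apply]
      have : ∀ y : Fin n → ℝ, l2 (u a.1) * (v a.2 ⬝ᵥ y) * (l2 (u b.1) * (v b.2 ⬝ᵥ y))
          = (l2 (u a.1) * l2 (u b.1)) * ((v a.2 ⬝ᵥ y) * (v b.2 ⬝ᵥ y)) := fun y => by ring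
      simp_rw [this]
      rw [integral_const_mul, gaussPi_cov]
    · simp_rw [dotCLM_apply]; exact gaussPi_cov _ _
  have key := gordon_finite (((μX n d).prod (gaussianReal 0 1)).map A)
    (((gaussPi n).prod (gaussPi d)).map B) mA mB (fun a b h => by
      rw [cA, cB, h, ← sq, l2_sq]; ring) (fun a b _ => by
      rw [cA, cB]
      have h1 := dot_le_l2 (u a.1) (u b.1)
      have h2 := dot_le_l2 (v a.2) (v b.2)
      rw [hv, hv] at h2
      nlinarith) l hη
  have sA : MeasurableSet {x : I × J → ℝ | ∀ i, ∃ j, l (i, j) + η ≤ x (i, j)} := by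
    have : {x : I × J → ℝ | ∀ i, ∃ j, l (i, j) + η ≤ x (i, j)}
        = ⋂ i, ⋃ j, {x : I × J → ℝ | l (i, j) + η ≤ x (i, j)} := by ext; simp
    rw [this]
    have : Countable I := Finite.to_countable
    refine MeasurableSet.iInter fun i => MeasurableSet.iUnion fun j => ?_
    exact measurableSet_le measurable_const (measurable_pi_apply _)
  have sB : MeasurableSet {x : I × J → ℝ | ∀ i, ∃ j, l (i, j) < x (i, j)} := by
    have : {x : I × J → ℝ | ∀ i, ∃ j, l (i, j) < x (i, j)}
        = ⋂ i, ⋃ j, {x : I × J → ℝ | l (i, j) < x (i, j)} := by ext; simp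
    rw [this]
    refine MeasurableSet.iInter fun i => MeasurableSet.iUnion fun j => ?_
    exact measurableSet_lt measurable_const (measurable_pi_apply _)
  rw [Measure.map_apply (by fun_prop) sA, Measure.map_apply (by fun_prop) sB] at key
  refine le_trans (le_of_eq ?_) (key.trans (le_of_eq ?_))
  · congr 1
  · congr 1; ext q
    simp only [Set.mem_preimage, Set.mem_setOf_eq, Aa, matCLM_apply]
    simp [mul_comm]

lemma exists_net (n : ℕ) (hn : 0 < n) {η : ℝ} (hη : 0 < η) :
    ∃ S : Finset (Fin n → ℝ), (∀ v ∈ S, l2 v = 1) ∧ ∀ x : Fin n → ℝ, ∃ v ∈ S, (1 - η) * l2 x ≤ v ⬝ᵥ x := by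
  classical
  have hc := (isCompact_sphere (0 : EuclideanSpace ℝ (Fin n)) 1)
  obtain ⟨s, hs, hfin, hcov⟩ := hc.finite_cover_balls hη
  refine ⟨hfin.toFinset.image (fun v => v.ofLp), ?_, ?_⟩
  · intro v hv
    simp only [Finset.mem_image, Set.Finite.mem_toFinset] at hv
    obtain ⟨w, hw, rfl⟩ := hv
    have := hs hw
    rw [l2_eq_norm]
    simpa using this
  · have main : ∀ x : EuclideanSpace ℝ (Fin n), ‖x‖ = 1 → ∃ v ∈ s, ‖x - v‖ ≤ η := by
      intro x hx
      have := hcov (show x ∈ Metric.sphere (0 : EuclideanSpace ℝ (Fin n)) 1 by simpa using hx)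
      simp only [Set.mem_iUnion] at this
      obtain ⟨v, hv, hxv⟩ := this
      refine ⟨v, hv, ?_⟩
      rw [← dist_eq_norm]; exact (Metric.mem_ball.1 hxv).le
    intro x
    by_cases hx : l2 x = 0
    · obtain ⟨v, hv, -⟩ := main (EuclideanSpace.single ⟨0, hn⟩ 1) (by simp)
      refine ⟨v.ofLp, ?_, ?_⟩
      · simp only [Finset.mem_image, Set.Finite.mem_toFinset]; exact ⟨v, hv, rfl⟩
      · rw [hx, l2_eq_zero hx]; simp
    · have hpos : 0 < l2 x := lt_of_le_of_ne (l2_nonneg x) (Ne.symm hx)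
      obtain ⟨v, hv, hd⟩ := main (WithLp.toLp 2 ((l2 x)⁻¹ • x)) (by
        rw [← l2_eq_norm, l2_smul, abs_of_pos (inv_pos.2 hpos), inv_mul_cancel₀ hx])
      refine ⟨v.ofLp, ?_, ?_⟩
      · simp only [Finset.mem_image, Set.Finite.mem_toFinset]; exact ⟨v, hv, rfl⟩
      · have hd' : l2 ((l2 x)⁻¹ • x - v.ofLp) ≤ η := by
          rw [l2_eq_norm, WithLp.toLp_sub]; exact hd
        have h1 := dot_le_l2 ((l2 x)⁻¹ • x - v.ofLp) x
        rw [sub_dotProduct, smul_dotProduct, ← l2_sq, smul_eq_mul] at h1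
        have h2 : (l2 x)⁻¹ * l2 x ^ 2 = l2 x := by field_simp
        rw [h2] at h1
        nlinarith

lemma gordon_fin_norm {n d : ℕ} (hn : 0 < n) {I : Type*} [Fintype I]
    (w : I → (Fin n → ℝ) × (Fin d → ℝ)) (κ : I → ℝ) {η : ℝ} (hη : 0 < η) :
    ((gaussPi n).prod (gaussPi d))
      {q | ∀ i, κ i + η ≤ (1 - η) * l2 (l2 (w i).2 • q.1 - (w i).1) + (w i).2 ⬝ᵥ q.2}
    ≤ ((μX n d).prod (gaussianReal 0 1))
      {q | ∀ i, κ i ≤ l2 ((fun r => (w i).2 ⬝ᵥ q.1 r) - (w i).1) + q.2 * l2 (w i).2} := by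
  obtain ⟨S, hS, hnet⟩ := exists_net n hn hη
  have key := gordon_proc_finite (n := n) (I := I) (J := S) (fun i => (w i).2) (fun j => j.1)
    (fun j => hS j.1 j.2) (fun a => κ a.1 + a.2.1 ⬝ᵥ (w a.1).1) hη
  refine le_trans (measure_mono ?_) (key.trans (measure_mono ?_))
  · intro q hq i
    obtain ⟨v, hv, h⟩ := hnet (l2 (w i).2 • q.1 - (w i).1)
    refine ⟨⟨v, hv⟩, ?_⟩
    have := hq i
    rw [dotProduct_sub, dotProduct_smul, smul_eq_mul] at h
    dsimp only
    linarith
  · intro q hq i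
    obtain ⟨j, hj⟩ := hq i
    have := dot_le_l2 j.1 ((fun r => (w i).2 ⬝ᵥ q.1 r) - (w i).1)
    rw [hS _ j.2, one_mul, dotProduct_sub] at this
    dsimp only at hj
    linarith

lemma gordon_inf {n d : ℕ} (hn : 0 < n) (K : Set ((Fin n → ℝ) × (Fin d → ℝ)))
    (κ : (Fin n → ℝ) × (Fin d → ℝ) → ℝ) (hκ : Continuous κ) {η : ℝ} (hη : 0 < η) :
    ((gaussPi n).prod (gaussPi d))
      {q | ∀ p ∈ K, κ p + η ≤ (1 - η) * l2 (l2 p.2 • q.1 - p.1) + p.2 ⬝ᵥ q.2}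
    ≤ ((μX n d).prod (gaussianReal 0 1))
      {q | ∀ p ∈ K, κ p ≤ l2 ((fun r => p.2 ⬝ᵥ q.1 r) - p.1) + q.2 * l2 p.2} := by
  rcases K.eq_empty_or_nonempty with rfl | hne
  · simp
  have : Nonempty K := hne.to_subtype
  set D : ℕ → K := TopologicalSpace.denseSeq K
  have c2 : Continuous (fun v : Fin n → ℝ => l2 v) := continuous_l2
  have c2d : Continuous (fun v : Fin d → ℝ => l2 v) := continuous_l2
  have cont1 : ∀ q : (Fin n → Fin d → ℝ) × ℝ, Continuous (fun p : (Fin n → ℝ) × (Fin d → ℝ) =>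
      l2 ((fun r => p.2 ⬝ᵥ q.1 r) - p.1) + q.2 * l2 p.2) := by
    intro q
    refine (c2.comp ?_).add (continuous_const.mul (c2d.comp continuous_snd))
    refine Continuous.sub ?_ continuous_fst
    exact continuous_pi fun r => by unfold dotProduct; fun_prop
  have cont2 : ∀ p : (Fin n → ℝ) × (Fin d → ℝ), Continuous (fun q : (Fin n → Fin d → ℝ) × ℝ =>
      l2 ((fun r => p.2 ⬝ᵥ q.1 r) - p.1) + q.2 * l2 p.2) := by
    intro p
    refine (c2.comp ?_).add (continuous_snd.mul continuous_const)
    refine Continuous.sub ?_ continuous_const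
    exact continuous_pi fun r => by unfold dotProduct; fun_prop
  set B : ℕ → Set ((Fin n → Fin d → ℝ) × ℝ) := fun m => {q | ∀ i : Fin m,
    κ (D i) ≤ l2 ((fun r => (D i).1.2 ⬝ᵥ q.1 r) - (D i).1.1) + q.2 * l2 (D i).1.2} with hB
  have hBm : ∀ m, MeasurableSet (B m) := by
    intro m
    have : B m = ⋂ i : Fin m, {q | κ (D i) ≤ l2 ((fun r => (D i).1.2 ⬝ᵥ q.1 r) - (D i).1.1)
        + q.2 * l2 (D i).1.2} := by ext; simp [hB]
    rw [this]
    exact MeasurableSet.iInter fun i => (isClosed_le continuous_const (cont2 (D i))).measurableSet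
  have hanti : Antitone B := by
    intro a b hab q hq i
    exact hq ⟨i, lt_of_lt_of_le i.2 hab⟩
  have hset : {q : (Fin n → Fin d → ℝ) × ℝ | ∀ p ∈ K,
      κ p ≤ l2 ((fun r => p.2 ⬝ᵥ q.1 r) - p.1) + q.2 * l2 p.2} = ⋂ m, B m := by
    ext q
    simp only [Set.mem_setOf_eq, Set.mem_iInter]
    constructor
    · intro h m i; exact h _ (D i).2
    · intro h p hp
      have hcl : IsClosed {p : K | κ p ≤ l2 ((fun r => p.1.2 ⬝ᵥ q.1 r) - p.1.1) + q.2 * l2 p.1.2} :=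
        isClosed_le (hκ.comp continuous_subtype_val) ((cont1 q).comp continuous_subtype_val)
      have hall : (Set.range D) ⊆ {p : K | κ p ≤ l2 ((fun r => p.1.2 ⬝ᵥ q.1 r) - p.1.1)
          + q.2 * l2 p.1.2} := by
        rintro _ ⟨i, rfl⟩
        exact h (i + 1) ⟨i, Nat.lt_succ_self i⟩
      have hd : Dense (Set.range D) := TopologicalSpace.denseRange_denseSeq K
      have := hcl.closure_subset_iff.2 hall (hd ⟨p, hp⟩)
      exact this
  rw [hset, hanti.measure_iInter (fun m => (hBm m).nullMeasurableSet) ⟨0, measure_ne_top _ _⟩]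
  refine le_iInf fun m => ?_
  refine le_trans (measure_mono ?_) (gordon_fin_norm hn (fun i : Fin m => (D i).1)
    (fun i => κ (D i)) hη)
  intro q hq i
  exact hq _ (D i).2

lemma gauss1_tail {τ : ℝ} (hτ : 0 ≤ τ) :
    gaussianReal 0 1 {x | τ ≤ x} ≤ ENNReal.ofReal (Real.exp (-τ ^ 2 / 2)) := by
  have h := gauss_tail (n := 1) (fun _ => 1) (by simp [l2]) hτ
  have mp := measurePreserving_eval (fun _ : Fin 1 => gaussianReal 0 1) 0
  have := mp.measure_preimage (s := {x | τ ≤ x}) (measurableSet_Ici).nullMeasurableSet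
  rw [← this]
  refine le_trans (le_of_eq ?_) h
  congr 1
  ext g; simp [dotProduct]

lemma gordon_mat {n d : ℕ} (hn : 0 < n) (K : Set ((Fin n → ℝ) × (Fin d → ℝ)))
    (κ : ℝ) {η τ : ℝ} (hη : 0 < η) (hτ : 0 ≤ τ) :
    (μX n d) {X | ¬ ∀ p ∈ K, κ ≤ l2 ((fun r => p.2 ⬝ᵥ X r) - p.1)}
    ≤ ((gaussPi n).prod (gaussPi d))
      {q | ¬ ∀ p ∈ K, κ + τ * l2 p.2 + η ≤ (1 - η) * l2 (l2 p.2 • q.1 - p.1) + p.2 ⬝ᵥ q.2}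
      + ENNReal.ofReal (Real.exp (-τ ^ 2 / 2)) := by
  have c2 : Continuous (fun v : Fin n → ℝ => l2 v) := continuous_l2
  have c2d : Continuous (fun v : Fin d → ℝ => l2 v) := continuous_l2
  have key := gordon_inf hn K (fun p => κ + τ * l2 p.2)
    (continuous_const.add (continuous_const.mul (c2d.comp continuous_snd))) hη
  set SY := {q : (Fin n → ℝ) × (Fin d → ℝ) | ∀ p ∈ K,
    κ + τ * l2 p.2 + η ≤ (1 - η) * l2 (l2 p.2 • q.1 - p.1) + p.2 ⬝ᵥ q.2}
  set SX := {q : (Fin n → Fin d → ℝ) × ℝ | ∀ p ∈ K,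
    κ + τ * l2 p.2 ≤ l2 ((fun r => p.2 ⬝ᵥ q.1 r) - p.1) + q.2 * l2 p.2}
  have mY : MeasurableSet SY := by
    have : IsClosed SY := by
      have e : SY = ⋂ p ∈ K, {q | κ + τ * l2 p.2 + η
          ≤ (1 - η) * l2 (l2 p.2 • q.1 - p.1) + p.2 ⬝ᵥ q.2} := by
        ext; simp [SY]
      rw [e]
      refine isClosed_biInter fun p _ => isClosed_le continuous_const ?_
      refine (continuous_const.mul (c2.comp (by fun_prop))).add ?_
      unfold dotProduct; fun_prop
    exact this.measurableSet
  have mX : MeasurableSet SX := by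
    have : IsClosed SX := by
      have e : SX = ⋂ p ∈ K, {q | κ + τ * l2 p.2
          ≤ l2 ((fun r => p.2 ⬝ᵥ q.1 r) - p.1) + q.2 * l2 p.2} := by
        ext; simp [SX]
      rw [e]
      refine isClosed_biInter fun p _ => isClosed_le continuous_const ?_
      refine (c2.comp ?_).add (continuous_snd.mul continuous_const)
      refine Continuous.sub ?_ continuous_const
      exact continuous_pi fun r => by unfold dotProduct; fun_prop
    exact this.measurableSet
  have hcompl : ((μX n d).prod (gaussianReal 0 1)) SXᶜ ≤ ((gaussPi n).prod (gaussPi d)) SYᶜ := by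
    rw [prob_compl_eq_one_sub mX, prob_compl_eq_one_sub mY]
    exact tsub_le_tsub_left key 1
  set bad := {X : Fin n → Fin d → ℝ | ¬ ∀ p ∈ K, κ ≤ l2 ((fun r => p.2 ⬝ᵥ X r) - p.1)}
  have h1 : (μX n d) bad = ((μX n d).prod (gaussianReal 0 1)) (bad ×ˢ Set.univ) := by
    rw [Measure.prod_prod]; simp
  have h2 : (bad ×ˢ (Set.univ : Set ℝ)) ⊆ SXᶜ ∪ (Set.univ ×ˢ {x : ℝ | τ ≤ x}) := by
    rintro ⟨X, g⟩ ⟨hX, -⟩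
    by_cases hg : τ ≤ g
    · right; exact ⟨Set.mem_univ _, hg⟩
    · left
      intro hS
      apply hX
      intro p hp
      have := hS p hp
      dsimp only at this
      push Not at hg
      nlinarith [l2_nonneg p.2, mul_nonneg (l2_nonneg p.2) (sub_nonneg.2 hg.le)]
  rw [h1]
  refine (measure_mono h2).trans ((measure_union_le _ _).trans (add_le_add hcompl ?_))
  rw [Measure.prod_prod, measure_univ, one_mul]
  exact gauss1_tail hτ

lemma integrable_l2_mulVec {n m : ℕ} (A : Matrix (Fin m) (Fin n) ℝ) :
    Integrable (fun g => l2 (A *ᵥ g) ^ 2) (gaussPi n) ∧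
    ∫ g, l2 (A *ᵥ g) ^ 2 ∂(gaussPi n) = ∑ i, A i ⬝ᵥ A i := by
  have e : ∀ g : Fin n → ℝ, l2 (A *ᵥ g) ^ 2 = ∑ i, (A i ⬝ᵥ g) * (A i ⬝ᵥ g) := by
    intro g; rw [l2_sq]; rfl
  have hi : ∀ i, Integrable (fun g : Fin n → ℝ => (A i ⬝ᵥ g) * (A i ⬝ᵥ g)) (gaussPi n) :=
    fun i => (gaussPi_memLp (A i)).integrable_mul (gaussPi_memLp (A i))
  simp only [e]
  refine ⟨integrable_finsetSum _ fun i _ => hi i, ?_⟩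
  rw [integral_finsetSum _ fun i _ => hi i]
  exact Finset.sum_congr rfl fun i _ => gaussPi_cov _ _

lemma integrable_l2_sq (n : ℕ) : Integrable (fun g => l2 g ^ 2) (gaussPi n) ∧
    ∫ g, l2 g ^ 2 ∂(gaussPi n) = n := by
  have := integrable_l2_mulVec (1 : Matrix (Fin n) (Fin n) ℝ)
  simp only [one_mulVec] at this
  refine ⟨this.1, this.2.trans ?_⟩
  simp [dotProduct, Matrix.one_apply]

lemma integrable_l2 (n : ℕ) : Integrable (fun g => l2 g) (gaussPi n) := by
  refine Integrable.mono' ((integrable_l2_sq n).1.add (integrable_const (1 : ℝ)))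
    continuous_l2.aestronglyMeasurable (Filter.Eventually.of_forall fun g => ?_)
  rw [Real.norm_of_nonneg (l2_nonneg g)]
  simp only [Pi.add_apply]
  nlinarith [sq_nonneg (l2 g - 1), l2_nonneg g]

lemma nu_nonneg (n : ℕ) : 0 ≤ nu n := integral_nonneg fun g => l2_nonneg g

lemma nu_le (n : ℕ) (hn : 0 < n) : nu n ≤ Real.sqrt n := by
  have hn' : (0 : ℝ) < n := by exact_mod_cast hn
  have hs : 0 < Real.sqrt n := Real.sqrt_pos.2 hn'
  have h1 : nu n ≤ ∫ g, ((2 * Real.sqrt n)⁻¹ * l2 g ^ 2 + Real.sqrt n / 2) ∂(gaussPi n) := by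
    refine integral_mono (integrable_l2 n)
      (((integrable_l2_sq n).1.const_mul _).add (integrable_const _)) fun g => ?_
    dsimp only
    have : l2 g = (2 * Real.sqrt n)⁻¹ * (2 * Real.sqrt n * l2 g) := by field_simp
    have e : Real.sqrt n / 2 = (2 * Real.sqrt n)⁻¹ * (Real.sqrt n ^ 2) := by field_simp
    rw [e, ← mul_add]
    conv_lhs => rw [this]
    exact mul_le_mul_of_nonneg_left (by nlinarith [sq_nonneg (l2 g - Real.sqrt n)]) (by positivity)
  rw [integral_add ((integrable_l2_sq n).1.const_mul _) (integrable_const _),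
    integral_const_mul, (integrable_l2_sq n).2] at h1
  have : (2 * Real.sqrt n)⁻¹ * (n : ℝ) = Real.sqrt n / 2 := by
    have := Real.sq_sqrt hn'.le
    field_simp
    exact this.symm
  rw [this] at h1
  simpa using h1

def gsup {n : ℕ} (K : Set (Fin n → ℝ)) (g : Fin n → ℝ) : ℝ :=
  sSup ((fun x => |∑ i, g i * x i|) '' K)

lemma gsup_le {n : ℕ} {K : Set (Fin n → ℝ)} (hK : ∀ t ∈ K, l2 t ≤ 1) (g : Fin n → ℝ) :
    gsup K g ≤ l2 g := by
  refine Real.sSup_le ?_ (l2_nonneg g)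
  rintro _ ⟨x, hx, rfl⟩
  have := abs_dot_le_l2 g x
  exact this.trans (mul_le_of_le_one_right (l2_nonneg g) (hK x hx))

lemma gsup_bdd {n : ℕ} {K : Set (Fin n → ℝ)} (hK : ∀ t ∈ K, l2 t ≤ 1) (g : Fin n → ℝ) :
    BddAbove ((fun x => |∑ i, g i * x i|) '' K) := by
  refine ⟨l2 g, ?_⟩
  rintro _ ⟨x, hx, rfl⟩
  have := abs_dot_le_l2 g x
  exact this.trans (mul_le_of_le_one_right (l2_nonneg g) (hK x hx))

lemma gsup_nonneg {n : ℕ} (K : Set (Fin n → ℝ)) (g : Fin n → ℝ) : 0 ≤ gsup K g := by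
  refine Real.sSup_nonneg ?_
  rintro _ ⟨x, hx, rfl⟩
  exact abs_nonneg _

lemma le_gsup {n : ℕ} {K : Set (Fin n → ℝ)} (hK : ∀ t ∈ K, l2 t ≤ 1) (g : Fin n → ℝ)
    {t : Fin n → ℝ} (ht : t ∈ K) : t ⬝ᵥ g ≤ gsup K g := by
  have := le_csSup (gsup_bdd hK g) ⟨t, ht, rfl⟩
  rw [dotProduct_comm]
  exact (le_abs_self _).trans this

lemma gsup_meas {n : ℕ} {K : Set (Fin n → ℝ)} (hK : ∀ t ∈ K, l2 t ≤ 1) :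
    Measurable (gsup K) := by
  have e : gsup K = fun g => ⨆ x : K, |∑ i, g i * x.1 i| := by
    funext g
    rw [gsup, sSup_image']
  rw [e]
  apply LowerSemicontinuous.measurable
  refine lowerSemicontinuous_ciSup (fun g => ?_) fun x => ?_
  · have := gsup_bdd hK g
    rw [Set.image_eq_range] at this
    exact this
  · exact Continuous.lowerSemicontinuous (by fun_prop)

lemma gsup_integrable {n : ℕ} {K : Set (Fin n → ℝ)} (hK : ∀ t ∈ K, l2 t ≤ 1) :
    Integrable (gsup K) (gaussPi n) := by
  refine Integrable.mono' (integrable_l2 n) (gsup_meas hK).aestronglyMeasurable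
    (Filter.Eventually.of_forall fun g => ?_)
  rw [Real.norm_of_nonneg (gsup_nonneg K g)]
  exact gsup_le hK g

lemma gwidth_nonneg {n : ℕ} (K : Set (Fin n → ℝ)) : 0 ≤ gwidth K :=
  integral_nonneg fun g => gsup_nonneg K g

/-- Markov plus concentration. -/
lemma conc_markov {n : ℕ} (hn : 0 < n) {T : Set (Fin n → ℝ)} (hT : ∀ t ∈ T, l2 t ≤ 1)
    {f : (Fin n → ℝ) → ℝ} (hf : Integrable f (gaussPi n)) (hf0 : ∀ g, 0 ≤ f g)
    {w c δ : ℝ} (hw : ∫ g, f g ∂(gaussPi n) ≤ w) (hδ : 0 < δ) (hw0 : 0 < w)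
    (hc : ∀ g, f g < (1 + δ) * w → ∀ t ∈ T, t ⬝ᵥ g ≤ c) :
    gaussPi n {g | ∃ t ∈ T, 2 * c + 3 * (δ * Real.sqrt n) < t ⬝ᵥ g}
      ≤ ENNReal.ofReal (2 * (1 + δ) / δ * Real.exp (-(δ ^ 2 / 2) * n)) := by
  have hm := mul_meas_ge_le_integral_of_nonneg (μ := gaussPi n)
    (Filter.Eventually.of_forall hf0) hf ((1 + δ) * w)
  have h1 : (gaussPi n).real {g | (1 + δ) * w ≤ f g} ≤ 1 / (1 + δ) := by
    rw [le_div_iff₀ (by linarith)]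
    have := hm.trans hw
    by_contra hh
    push Not at hh
    nlinarith
  have hp : ENNReal.ofReal (δ / (1 + δ)) ≤ gaussPi n {g | ∀ t ∈ T, t ⬝ᵥ g ≤ c} := by
    have hsub : {g | (1 + δ) * w ≤ f g}ᶜ ⊆ {g | ∀ t ∈ T, t ⬝ᵥ g ≤ c} := by
      intro g hg
      simp only [Set.mem_compl_iff, Set.mem_setOf_eq, not_le] at hg
      exact hc g hg
    refine le_trans ?_ (measure_mono hsub)
    rw [prob_compl_eq_one_sub₀ (nullMeasurableSet_le aemeasurable_const hf.1.aemeasurable),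
      ← ENNReal.ofReal_toReal (measure_ne_top (gaussPi n) {g | (1 + δ) * w ≤ f g}),
      ← ENNReal.ofReal_one, ← ENNReal.ofReal_sub _ ENNReal.toReal_nonneg]
    apply ENNReal.ofReal_le_ofReal
    have e : δ / (1 + δ) = 1 - 1 / (1 + δ) := by field_simp; ring
    rw [e]
    exact sub_le_sub_left h1 1
  refine (conc T hT (by positivity) (by positivity) hp).trans (ENNReal.ofReal_le_ofReal ?_)
  apply le_of_eq
  rw [mul_pow, Real.sq_sqrt (Nat.cast_nonneg n)]
  congr 1
  · field_simp
  · congr 1; ring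

lemma conc_width {n : ℕ} (hn : 0 < n) {T : Set (Fin n → ℝ)} (hT : ∀ t ∈ T, l2 t ≤ 1)
    {δ : ℝ} (hδ : 0 < δ) (hδ1 : δ < 1) :
    gaussPi n {g | ∃ t ∈ T, 2 * (1 + δ) * gwidth T + 7 * δ * Real.sqrt n < t ⬝ᵥ g}
      ≤ ENNReal.ofReal (2 * (1 + δ) / δ * Real.exp (-(δ ^ 2 / 2) * n)) := by
  have hs : 0 < Real.sqrt n := Real.sqrt_pos.2 (by exact_mod_cast hn)
  have hw := gwidth_nonneg T
  refine le_trans (measure_mono ?_) (conc_markov hn hT (gsup_integrable hT) (gsup_nonneg T)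
    (w := gwidth T + δ * Real.sqrt n) (c := (1 + δ) * (gwidth T + δ * Real.sqrt n)) ?_ hδ
    (by positivity) ?_)
  · rintro g ⟨t, ht, h⟩
    refine ⟨t, ht, lt_of_le_of_lt ?_ h⟩
    have : δ * (δ * Real.sqrt n) ≤ 1 * (δ * Real.sqrt n) := by gcongr
    nlinarith
  · have : ∫ g, gsup T g ∂(gaussPi n) = gwidth T := rfl
    rw [this]
    have : 0 < δ * Real.sqrt n := by positivity
    linarith
  · intro g hg t ht
    exact (le_gsup hT g ht).trans hg.le

lemma quad_nonneg {A B C s : ℝ} (hA : 0 < A) (h : B ^ 2 ≤ A * C) :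
    0 ≤ A - 2 * (B * s) + C * s ^ 2 := by
  have : 0 ≤ A * (A - 2 * (B * s) + C * s ^ 2) := by
    nlinarith [sq_nonneg (A - B * s), mul_le_mul_of_nonneg_right h (sq_nonneg s)]
  exact nonneg_of_mul_nonneg_right this hA

lemma l2_sub_sq {n : ℕ} (v w : Fin n → ℝ) :
    l2 (v - w) ^ 2 = l2 v ^ 2 - 2 * (v ⬝ᵥ w) + l2 w ^ 2 := by
  rw [l2_sq, l2_sq, l2_sq, sub_dotProduct, dotProduct_sub, dotProduct_sub, dotProduct_comm w v]
  ring

lemma b1_det {δ ε x ρ ω A B C s G2 W a N : ℝ} (hδ : 0 < δ) (hδ1 : δ < 1) (hε : 0 < ε)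
    (hN : 0 < N) (ha : 0 ≤ a)
    (hs : s = a * N) (hA : A = (1 - δ) ^ 2 - (ε + δ) ^ 2)
    (hB : B = (1 - δ) ^ 2 * ω + (ε + δ) * ρ) (hC : C = (1 - δ) ^ 3 - ρ ^ 2)
    (hA0 : 0 < A) (hBC : B ^ 2 ≤ A * C)
    (hG : (1 - δ) * N ^ 2 ≤ G2) (hW : W ≤ ω * N) (hx : x ^ 2 = a ^ 2 * G2 - 2 * (a * W) + 1)
    (hx0 : 0 ≤ x) (hρ : 0 ≤ ρ) :
    ε + δ + ρ * s ≤ (1 - δ) * x := by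
  have hs0 : 0 ≤ s := by rw [hs]; positivity
  have h1 : (1 - δ) * s ^ 2 - 2 * (ω * s) + 1 ≤ x ^ 2 := by
    rw [hx, hs]
    have := mul_le_mul_of_nonneg_left hG (sq_nonneg a)
    have := mul_le_mul_of_nonneg_left hW ha
    nlinarith
  have h2 := quad_nonneg (s := s) hA0 hBC
  rw [hA, hB, hC] at h2
  have h3 : (ε + δ + ρ * s) ^ 2 ≤ ((1 - δ) * x) ^ 2 := by
    rw [mul_pow]
    have := mul_le_mul_of_nonneg_left h1 (sq_nonneg (1 - δ))
    nlinarith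
  exact le_of_sq_le_sq h3 (by have : 0 < 1 - δ := by linarith
                              positivity)

lemma prod_union3 {n d : ℕ} (S : Set ((Fin n → ℝ) × (Fin d → ℝ))) (A1 A2 : Set (Fin n → ℝ))
    (A3 : Set (Fin d → ℝ)) (h : ∀ q, q.1 ∉ A1 → q.1 ∉ A2 → q.2 ∉ A3 → q ∉ S) :
    ((gaussPi n).prod (gaussPi d)) S ≤ gaussPi n A1 + gaussPi n A2 + gaussPi d A3 := by
  have hsub : S ⊆ (A1 ×ˢ Set.univ ∪ A2 ×ˢ Set.univ) ∪ Set.univ ×ˢ A3 := by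
    intro q hq
    by_contra hh
    simp only [Set.mem_union, Set.mem_prod, Set.mem_univ, and_true, true_and, not_or] at hh
    exact h q hh.1.1 hh.1.2 hh.2 hq
  refine (measure_mono hsub).trans ((measure_union_le _ _).trans
    (add_le_add ((measure_union_le _ _).trans (le_of_eq ?_)) (le_of_eq ?_)))
  · rw [Measure.prod_prod, Measure.prod_prod]; simp
  · rw [Measure.prod_prod]; simp

lemma event_b1 {n d : ℕ} (hn : 0 < n) {T : Set (Fin n → ℝ)} (hT : ∀ t ∈ T, l2 t = 1)
    {ε δ r ω ρ A B C : ℝ} (hε : 0 < ε) (hδ : 0 < δ) (hδ1 : δ < 1) (hr : r = d / n)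
    (hw : 2 * gwidth T ≤ (1 - ε) * (Real.sqrt (1 - r) * Real.sqrt n))
    (hω : ω = (1 + δ) * ((1 - ε) * Real.sqrt (1 - r)) + 7 * δ)
    (hρ : ρ = δ + Real.sqrt ((1 + δ) * r))
    (hA : A = (1 - δ) ^ 2 - (ε + δ) ^ 2)
    (hB : B = (1 - δ) ^ 2 * ω + (ε + δ) * ρ) (hC : C = (1 - δ) ^ 3 - ρ ^ 2)
    (hA0 : 0 < A) (hBC : B ^ 2 ≤ A * C) :
    μX n d {X | ¬ ∀ t ∈ T, ∀ u : Fin d → ℝ, ε ≤ l2 ((fun r => u ⬝ᵥ X r) - t)} ≤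
      ENNReal.ofReal (chiRate (-δ) ^ n)
      + ENNReal.ofReal (2 * (1 + δ) / δ * Real.exp (-(δ ^ 2 / 2) * n))
      + ENNReal.ofReal (chiRate δ ^ d)
      + ENNReal.ofReal (Real.exp (-(δ ^ 2 / 2) * n)) := by
  have hn' : (0 : ℝ) < n := by exact_mod_cast hn
  have hs : 0 < Real.sqrt n := Real.sqrt_pos.2 hn'
  have hsq : Real.sqrt n ^ 2 = n := Real.sq_sqrt hn'.le
  have g := gordon_mat (n := n) (d := d) hn {p | p.1 ∈ T} ε (η := δ) (τ := δ * Real.sqrt n)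
    hδ (by positivity)
  have e1 : -(δ * Real.sqrt n) ^ 2 / 2 = -(δ ^ 2 / 2) * n := by rw [mul_pow, hsq]; ring
  rw [e1] at g
  refine le_trans (measure_mono ?_) (g.trans (add_le_add ((prod_union3 _ _ _ _ ?_).trans
    (add_le_add (add_le_add (chi_lower hδ hδ1 n) (conc_width hn (fun t ht => (hT t ht).le) hδ hδ1))
      (chi_upper hδ d))) le_rfl))
  · intro X hX h
    exact hX fun t ht u => h (t, u) ht
  · rintro ⟨q, q2⟩ h1 h2 h3 h4
    apply h4
    rintro ⟨t, u⟩ ht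
    simp only [Set.mem_setOf_eq, not_not, not_exists, not_and, not_lt] at h1 h2 h3 ht
    have ha := l2_nonneg u
    have hx := l2_sub_sq (l2 u • q) t
    rw [l2_smul, abs_of_nonneg ha, mul_pow, hT t ht, smul_dotProduct, smul_eq_mul, one_pow,
      dotProduct_comm] at hx
    have hr0 : 0 ≤ r := by rw [hr]; positivity
    have hρ0 : 0 ≤ ρ := by rw [hρ]; positivity
    have := b1_det (x := l2 (l2 u • q - t)) (a := l2 u) (N := Real.sqrt n) (G2 := l2 q ^ 2)
      (W := t ⬝ᵥ q) hδ hδ1 hε hs ha rfl hA hB hC hA0 hBC (by rw [hsq]; exact h1)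
      ((h2 t ht).trans (by
        rw [hω]
        have := mul_le_mul_of_nonneg_left hw (by linarith : 0 ≤ 1 + δ)
        nlinarith)) hx (l2_nonneg _) hρ0
    have h5 : l2 q2 ≤ Real.sqrt ((1 + δ) * r) * Real.sqrt n := by
      rw [← Real.sqrt_mul (by positivity)]
      apply Real.le_sqrt_of_sq_le
      have : (1 + δ) * r * n = (1 + δ) * d := by rw [hr]; field_simp
      rw [this]; exact h3
    have h6 := abs_dot_le_l2 u q2
    have h7 := neg_abs_le (u ⬝ᵥ q2)
    have h8 := mul_le_mul_of_nonneg_left h5 ha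
    dsimp only
    rw [hρ] at this
    nlinarith

lemma event_b2 {n d : ℕ} (hn : 0 < n)
    {δ r κ : ℝ} (hδ : 0 < δ) (hδ1 : δ < 1) (hr : r = d / n)
    (hκ : κ + 2 * δ ≤ (1 - δ) * Real.sqrt (1 - δ) - Real.sqrt ((1 + δ) * r)) :
    μX n d {X | ¬ ∀ u : Fin d → ℝ, κ * Real.sqrt n * l2 u ≤ l2 (fun r => u ⬝ᵥ X r)} ≤
      ENNReal.ofReal (chiRate (-δ) ^ n)
      + ENNReal.ofReal (chiRate δ ^ d)
      + ENNReal.ofReal (Real.exp (-(δ ^ 2 / 2) * n)) := by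
  have hn' : (0 : ℝ) < n := by exact_mod_cast hn
  have hs : 0 < Real.sqrt n := Real.sqrt_pos.2 hn'
  have hs1 : 1 ≤ Real.sqrt n := Real.one_le_sqrt.2 (by exact_mod_cast hn)
  have hsq : Real.sqrt n ^ 2 = n := Real.sq_sqrt hn'.le
  have g := gordon_mat (n := n) (d := d) hn {p | p.1 = 0 ∧ l2 p.2 = 1} (κ * Real.sqrt n)
    (η := δ) (τ := δ * Real.sqrt n) hδ (by positivity)
  have e1 : -(δ * Real.sqrt n) ^ 2 / 2 = -(δ ^ 2 / 2) * n := by rw [mul_pow, hsq]; ring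
  rw [e1] at g
  refine le_trans (measure_mono ?_) (g.trans (add_le_add ((prod_union3 _ _ ∅ _ ?_).trans
    (add_le_add (add_le_add (chi_lower hδ hδ1 n) (le_of_eq measure_empty))
      (chi_upper hδ d)) |>.trans (by rw [add_zero])) le_rfl))
  · intro X hX h
    apply hX
    intro u
    rcases eq_or_ne (l2 u) 0 with h0 | h0
    · rw [h0, mul_zero]; exact l2_nonneg _
    · have hp : 0 < l2 u := lt_of_le_of_ne (l2_nonneg u) (Ne.symm h0)
      have := h (0, (l2 u)⁻¹ • u) ⟨rfl, by
        rw [l2_smul, abs_of_pos (inv_pos.2 hp), inv_mul_cancel₀ h0]⟩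
      dsimp only at this
      have e : (fun r => ((l2 u)⁻¹ • u) ⬝ᵥ X r) - 0 = (l2 u)⁻¹ • (fun r => u ⬝ᵥ X r) := by
        rw [sub_zero]; funext r; simp [smul_dotProduct]
      rw [e, l2_smul, abs_of_pos (inv_pos.2 hp)] at this
      rw [← le_div_iff₀ hp, div_eq_inv_mul]
      exact this
  · rintro ⟨q, q2⟩ h1 - h3 h4
    apply h4
    rintro ⟨t, u⟩ ⟨ht, hu⟩
    simp only [Set.mem_setOf_eq, not_not] at h1 h3 
    dsimp only at ht hu ⊢
    subst ht
    have hr0 : 0 ≤ r := by rw [hr]; positivity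
    have h5 : l2 q2 ≤ Real.sqrt ((1 + δ) * r) * Real.sqrt n := by
      rw [← Real.sqrt_mul (by positivity)]
      apply Real.le_sqrt_of_sq_le
      have : (1 + δ) * r * n = (1 + δ) * d := by rw [hr]; field_simp
      rw [this]; exact h3
    have h6 := abs_dot_le_l2 u q2
    have h7 := neg_abs_le (u ⬝ᵥ q2)
    have h8 : Real.sqrt (1 - δ) * Real.sqrt n ≤ l2 q := by
      rw [← Real.sqrt_mul (by linarith)]
      exact Real.sqrt_le_iff.2 ⟨l2_nonneg _, h1⟩
    rw [hu, one_smul, sub_zero]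
    rw [hu] at h6
    have h9 := mul_le_mul_of_nonneg_left h8 (by linarith : 0 ≤ 1 - δ)
    have h10 := mul_le_mul_of_nonneg_right hκ hs.le
    have h11 := mul_le_mul_of_nonneg_left hs1 hδ.le
    nlinarith

def projM {n d : ℕ} (X : Matrix (Fin n) (Fin d) ℝ) : Matrix (Fin n) (Fin n) ℝ :=
  X * (Xᵀ * X)⁻¹ * Xᵀ

lemma projM_symm {n d : ℕ} (X : Matrix (Fin n) (Fin d) ℝ) : (projM X)ᵀ = projM X := by
  unfold projM
  rw [transpose_mul, transpose_mul, transpose_transpose, transpose_nonsing_inv, transpose_mul,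
    transpose_transpose, Matrix.mul_assoc]

lemma projM_cases {n d : ℕ} (X : Matrix (Fin n) (Fin d) ℝ) :
    (Xᵀ * X)⁻¹ * (Xᵀ * X) = 1 ∨ (Xᵀ * X)⁻¹ = 0 := by
  by_cases h : IsUnit (Xᵀ * X).det
  · left; exact nonsing_inv_mul _ h
  · right; exact nonsing_inv_apply_not_isUnit _ h

lemma projM_idem {n d : ℕ} (X : Matrix (Fin n) (Fin d) ℝ) : projM X * projM X = projM X := by
  rcases projM_cases X with h | h
  · calc projM X * projM X = X * ((Xᵀ * X)⁻¹ * (Xᵀ * X)) * (Xᵀ * X)⁻¹ * Xᵀ := by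
          unfold projM; simp only [Matrix.mul_assoc]
      _ = projM X := by rw [h, Matrix.mul_one]; rfl
  · simp [projM, h]

lemma projM_trace {n d : ℕ} (X : Matrix (Fin n) (Fin d) ℝ) : (projM X).trace ≤ d := by
  rcases projM_cases X with h | h
  · unfold projM
    rw [Matrix.mul_assoc, trace_mul_comm, Matrix.mul_assoc, h, trace_one]; simp
  · simp [projM, h]

lemma projM_rows {n d : ℕ} (X : Matrix (Fin n) (Fin d) ℝ) :
    ∑ i, projM X i ⬝ᵥ projM X i ≤ d := by
  refine le_trans (le_of_eq ?_) (projM_trace X)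
  conv_rhs => rw [← projM_idem X]
  unfold Matrix.trace
  refine Finset.sum_congr rfl fun i _ => ?_
  rw [diag_apply, mul_apply']
  congr 1
  funext j
  have := congrFun (congrFun (projM_symm X) i) j
  rw [transpose_apply] at this
  exact this.symm

lemma projM_dot {n d : ℕ} (X : Matrix (Fin n) (Fin d) ℝ) (v w : Fin n → ℝ) :
    (projM X *ᵥ v) ⬝ᵥ w = v ⬝ᵥ (projM X *ᵥ w) := by
  rw [dotProduct_mulVec, ← mulVec_transpose, projM_symm]

lemma projM_sq {n d : ℕ} (X : Matrix (Fin n) (Fin d) ℝ) (v : Fin n → ℝ) :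
    l2 (projM X *ᵥ v) ^ 2 = v ⬝ᵥ (projM X *ᵥ v) := by
  rw [l2_sq, projM_dot, mulVec_mulVec, projM_idem]

lemma projM_l2_le {n d : ℕ} (X : Matrix (Fin n) (Fin d) ℝ) (v : Fin n → ℝ) :
    l2 (projM X *ᵥ v) ≤ l2 v := by
  have h := projM_sq X v
  have h2 := dot_le_l2 v (projM X *ᵥ v)
  rcases eq_or_lt_of_le (l2_nonneg (projM X *ᵥ v)) with h0 | h0
  · rw [← h0]; exact l2_nonneg v
  · nlinarith

lemma measurable_projM {n d : ℕ} :
    Measurable (fun q : (Fin n → Fin d → ℝ) × (Fin n → ℝ) => projM (Matrix.of q.1) *ᵥ q.2) := by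
  have hX : Continuous (fun q : (Fin n → Fin d → ℝ) × (Fin n → ℝ) =>
      ((Matrix.of q.1 : Matrix (Fin n) (Fin d) ℝ))) := continuous_fst
  have hG : Continuous (fun q : (Fin n → Fin d → ℝ) × (Fin n → ℝ) =>
      (Matrix.of q.1 : Matrix (Fin n) (Fin d) ℝ)ᵀ * Matrix.of q.1) :=
    (hX.matrix_transpose).matrix_mul hX
  have e : (fun q : (Fin n → Fin d → ℝ) × (Fin n → ℝ) => projM (Matrix.of q.1) *ᵥ q.2)
    = fun q => (((Matrix.of q.1)ᵀ * Matrix.of q.1).det)⁻¹ •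
      ((Matrix.of q.1 * adjugate ((Matrix.of q.1)ᵀ * Matrix.of q.1) * (Matrix.of q.1)ᵀ) *ᵥ q.2) := by
    funext q
    rw [projM, Matrix.inv_def, Ring.inverse_eq_inv, Matrix.mul_smul, Matrix.smul_mul, smul_mulVec]
  rw [e]
  refine Measurable.smul (hG.matrix_det.measurable.inv) (Continuous.measurable ?_)
  exact ((hX.matrix_mul hG.matrix_adjugate).matrix_mul hX.matrix_transpose).matrix_mulVec
    continuous_snd

lemma isOpen_exT {n : ℕ} (T : Set (Fin n → ℝ)) (c : ℝ) : IsOpen {y | ∃ t ∈ T, c < t ⬝ᵥ y} := by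
  have : {y | ∃ t ∈ T, c < t ⬝ᵥ y} = ⋃ t ∈ T, {y | c < t ⬝ᵥ y} := by ext; simp
  rw [this]
  exact isOpen_biUnion fun t _ => isOpen_lt continuous_const (cont_dot t)

lemma noise1 {n d : ℕ} (X : Matrix (Fin n) (Fin d) ℝ) (T : Set (Fin n → ℝ)) (c : ℝ) :
    gaussPi n {g | ∃ t ∈ T, c < t ⬝ᵥ (g - projM X *ᵥ g)}
      ≤ 2 * gaussPi n {g | ∃ t ∈ T, c < t ⬝ᵥ g} := by
  set R : Matrix (Fin n) (Fin n) ℝ := 1 - (2 : ℝ) • projM X with hR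
  have hRR : Rᵀ * R = 1 := by
    have : Rᵀ = R := by
      rw [hR, transpose_sub, transpose_smul, projM_symm, transpose_one]
    rw [this, hR, Matrix.sub_mul, Matrix.mul_sub, Matrix.one_mul, Matrix.one_mul, Matrix.smul_mul,
      Matrix.mul_sub, Matrix.mul_smul, projM_idem, Matrix.mul_one]
    module
  have hm := gaussPi_map_orth R hRR
  have hmeas : Measurable (fun g : Fin n → ℝ => R *ᵥ g) :=
    (continuous_const.matrix_mulVec continuous_id).measurable
  have h2 : gaussPi n {g | ∃ t ∈ T, c < t ⬝ᵥ (R *ᵥ g)} = gaussPi n {g | ∃ t ∈ T, c < t ⬝ᵥ g} := by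
    conv_rhs => rw [← hm, Measure.map_apply hmeas (isOpen_exT T c).measurableSet]
    rfl
  have hsub : {g | ∃ t ∈ T, c < t ⬝ᵥ (g - projM X *ᵥ g)} ⊆
      {g | ∃ t ∈ T, c < t ⬝ᵥ g} ∪ {g | ∃ t ∈ T, c < t ⬝ᵥ (R *ᵥ g)} := by
    rintro g ⟨t, ht, h⟩
    by_contra hh
    simp only [Set.mem_union, Set.mem_setOf_eq, not_or, not_exists, not_and, not_lt] at hh
    have h3 := hh.1 t ht
    have h4 := hh.2 t ht
    rw [hR, sub_mulVec, one_mulVec, smul_mulVec, dotProduct_sub, dotProduct_smul, smul_eq_mul] at h4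
    rw [dotProduct_sub] at h
    linarith
  refine (measure_mono hsub).trans ((measure_union_le _ _).trans ?_)
  rw [h2, two_mul]

lemma noise2 {n d : ℕ} (hn : 0 < n) (hd : 0 < d) (X : Matrix (Fin n) (Fin d) ℝ) {δ : ℝ}
    (hδ : 0 < δ) :
    gaussPi n {g | 2 * Real.sqrt ((1 + δ) * d) + 3 * (δ * Real.sqrt n) < l2 (projM X *ᵥ g)}
      ≤ ENNReal.ofReal (2 * (1 + δ) / δ * Real.exp (-(δ ^ 2 / 2) * n)) := by
  have hd' : (0 : ℝ) < d := by exact_mod_cast hd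
  have hi := integrable_l2_mulVec (projM X)
  refine le_trans (measure_mono ?_) (conc_markov hn
    (T := {s | ∃ t, l2 t ≤ 1 ∧ s = projM X *ᵥ t}) ?_ hi.1 (fun g => sq_nonneg _)
    (w := d) (c := Real.sqrt ((1 + δ) * d)) (hi.2.trans_le (projM_rows X)) hδ hd' ?_)
  · intro g hg
    simp only [Set.mem_setOf_eq] at hg
    have hp : 0 < l2 (projM X *ᵥ g) := lt_of_le_of_lt (by positivity) hg
    refine ⟨projM X *ᵥ ((l2 (projM X *ᵥ g))⁻¹ • (projM X *ᵥ g)), ⟨_, ?_, rfl⟩, ?_⟩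
    · rw [l2_smul, abs_of_pos (inv_pos.2 hp), inv_mul_cancel₀ hp.ne']
    · rw [projM_dot, smul_dotProduct, ← l2_sq, smul_eq_mul]
      refine hg.trans_eq ?_
      field_simp
  · rintro _ ⟨t, ht, rfl⟩
    exact (projM_l2_le X t).trans ht
  · rintro g hg _ ⟨t, ht, rfl⟩
    rw [projM_dot]
    refine (dot_le_l2 _ _).trans ?_
    have : l2 (projM X *ᵥ g) ≤ Real.sqrt ((1 + δ) * d) := Real.le_sqrt_of_sq_le hg.le
    have h2 := l2_nonneg (projM X *ᵥ g)
    nlinarith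

lemma noise_map {n : ℕ} (σ : ℝ) (π : Equiv.Perm (Fin n)) :
    (gaussPi n).map (fun g => σ • permVec π g) = μNoise n σ := by
  have h1 : (gaussPi n).map (fun g => permVec π g) = gaussPi n := by
    have := gaussPi_map_orth ((1 : Matrix (Fin n) (Fin n) ℝ).submatrix π id) (by
      rw [transpose_submatrix, submatrix_mul_equiv (e₂ := π)]
      simp)
    convert this using 2
    funext g i
    simp [permVec, mulVec, dotProduct, Matrix.one_apply]
  have hm : Measurable (fun g : Fin n → ℝ => permVec π g) :=
    measurable_pi_lambda _ fun i => measurable_pi_apply _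
  have e : (fun g : Fin n → ℝ => σ • permVec π g) = (fun g => σ • g) ∘ (fun g => permVec π g) := rfl
  have hm2 : Measurable (fun g : Fin n → ℝ => σ • g) := measurable_const_smul σ
  rw [e, ← Measure.map_map hm2 hm, h1]
  have e2 : (fun g : Fin n → ℝ => σ • g) = fun g i => (fun x => σ * x) (g i) := rfl
  rw [e2, Measure.pi_map_pi (fun i => (measurable_const_mul σ).aemeasurable)]
  congr 1
  funext i
  rw [gaussianReal_map_const_mul]
  congr 1
  · simp
  · rw [mul_one]; rfl

lemma noise_prob {n : ℕ} (σ : ℝ) : IsProbabilityMeasure (μNoise n σ) := by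
  have mψ : Measurable (fun g : Fin n → ℝ => σ • permVec 1 g) :=
    (measurable_pi_lambda _ fun i => measurable_pi_apply _ :
    Measurable (fun e : Fin n → ℝ => permVec 1 e)).const_smul σ
  rw [← noise_map σ 1]
  exact Measure.isProbabilityMeasure_map mψ.aemeasurable

lemma event_noise {n d : ℕ} (hn : 0 < n) (hd : 0 < d) {σ : ℝ} (hσ : 0 < σ)
    (π : Equiv.Perm (Fin n)) {T : Set (Fin n → ℝ)} (hT : ∀ t ∈ T, l2 t ≤ 1)
    {δ : ℝ} (hδ : 0 < δ) (hδ1 : δ < 1) :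
    μData n d σ {ω | (∃ t ∈ T, 2 * (1 + δ) * gwidth T + 7 * δ * Real.sqrt n
        < t ⬝ᵥ (σ⁻¹ • permVec π⁻¹ ω.2 - projM (Matrix.of ω.1) *ᵥ (σ⁻¹ • permVec π⁻¹ ω.2))) ∨
      2 * Real.sqrt ((1 + δ) * d) + 3 * (δ * Real.sqrt n)
        < l2 (projM (Matrix.of ω.1) *ᵥ (σ⁻¹ • permVec π⁻¹ ω.2)) }
      ≤ 3 * ENNReal.ofReal (2 * (1 + δ) / δ * Real.exp (-(δ ^ 2 / 2) * n)) := by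
  set E := ENNReal.ofReal (2 * (1 + δ) / δ * Real.exp (-(δ ^ 2 / 2) * n))
  set c1 := 2 * (1 + δ) * gwidth T + 7 * δ * Real.sqrt n
  set c2 := 2 * Real.sqrt ((1 + δ) * d) + 3 * (δ * Real.sqrt n)
  set B : Set ((Fin n → Fin d → ℝ) × (Fin n → ℝ)) :=
    {q | (∃ t ∈ T, c1 < t ⬝ᵥ (q.2 - projM (Matrix.of q.1) *ᵥ q.2)) ∨
      c2 < l2 (projM (Matrix.of q.1) *ᵥ q.2)} with hB
  have mB : MeasurableSet B := by
    refine MeasurableSet.union ?_ ?_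
    · exact (measurable_snd.sub measurable_projM) (isOpen_exT T c1).measurableSet
    · exact measurableSet_lt measurable_const (continuous_l2.measurable.comp measurable_projM)
  set φ : (Fin n → ℝ) → (Fin n → ℝ) := fun e => σ⁻¹ • permVec π⁻¹ e with hφ
  have mφ : Measurable φ := (measurable_pi_lambda _ fun i => measurable_pi_apply _ :
    Measurable (fun e : Fin n → ℝ => permVec π⁻¹ e)).const_smul σ⁻¹
  have mψ : Measurable (fun g : Fin n → ℝ => σ • permVec π g) :=
    (measurable_pi_lambda _ fun i => measurable_pi_apply _ :
    Measurable (fun e : Fin n → ℝ => permVec π e)).const_smul σ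
  have mB' : MeasurableSet {ω : (Fin n → Fin d → ℝ) × (Fin n → ℝ) | (ω.1, φ ω.2) ∈ B} :=
    (measurable_fst.prodMk (mφ.comp measurable_snd)) mB
  have hinv : ∀ g, φ (σ • permVec π g) = g := by
    intro g
    funext i
    simp [hφ, permVec, hσ.ne']
  change μData n d σ {ω | (ω.1, φ ω.2) ∈ B} ≤ 3 * E
  haveI := noise_prob (n := n) σ
  rw [μData, Measure.prod_apply mB']
  have hX : ∀ X : Fin n → Fin d → ℝ, μNoise n σ (Prod.mk X ⁻¹'
      {ω : (Fin n → Fin d → ℝ) × (Fin n → ℝ) | (ω.1, φ ω.2) ∈ B}) ≤ 3 * E := by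
    intro X
    rw [← noise_map σ π, Measure.map_apply mψ (measurable_prodMk_left mB')]
    have : (fun g : Fin n → ℝ => σ • permVec π g) ⁻¹' (Prod.mk X ⁻¹'
      {ω : (Fin n → Fin d → ℝ) × (Fin n → ℝ) | (ω.1, φ ω.2) ∈ B}) =
      {g | ∃ t ∈ T, c1 < t ⬝ᵥ (g - projM (Matrix.of X) *ᵥ g)} ∪
      {g | c2 < l2 (projM (Matrix.of X) *ᵥ g)} := by
      ext g
      simp only [Set.mem_preimage, Set.mem_setOf_eq, hinv, hB, Set.mem_union]
    rw [this]
    refine (measure_union_le _ _).trans ((add_le_add ((noise1 (Matrix.of X) T c1).trans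
      (mul_le_mul_right (conc_width hn hT hδ hδ1) 2)) (noise2 hn hd (Matrix.of X) hδ)).trans ?_)
    apply le_of_eq
    change 2 * E + E = 3 * E
    ring
  refine (lintegral_mono hX).trans ?_
  rw [lintegral_const, measure_univ, mul_one]

lemma projM_mulVec_X {n d : ℕ} (X : Matrix (Fin n) (Fin d) ℝ) {κ : ℝ} (hκ : 0 < κ)
    (h : ∀ u, κ * l2 u ≤ l2 (X *ᵥ u)) (u : Fin d → ℝ) : projM X *ᵥ (X *ᵥ u) = X *ᵥ u := by
  have hdet : IsUnit (Xᵀ * X).det := by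
    rw [isUnit_iff_ne_zero]
    intro h0
    obtain ⟨v, hv, hv0⟩ := Matrix.exists_mulVec_eq_zero_iff.2 h0
    have h1 : l2 (X *ᵥ v) ^ 2 = 0 := by
      rw [l2_sq, dotProduct_mulVec, ← mulVec_transpose, mulVec_mulVec, hv0, zero_dotProduct]
    have h2 : l2 (X *ᵥ v) = 0 := by simpa using h1
    have h3 := h v
    rw [h2] at h3
    have h4 : l2 v = 0 := le_antisymm (by nlinarith [l2_nonneg v]) (l2_nonneg v)
    exact hv (l2_eq_zero h4)
  rw [mulVec_mulVec, projM, Matrix.mul_assoc, Matrix.mul_assoc, nonsing_inv_mul _ hdet,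
    Matrix.mul_one]

lemma l2_permVec {n : ℕ} (π : Equiv.Perm (Fin n)) (v : Fin n → ℝ) : l2 (permVec π v) = l2 v := by
  unfold l2 permVec
  rw [Equiv.sum_comp π (fun i => v i ^ 2)]

lemma permVec_inv {n : ℕ} (π : Equiv.Perm (Fin n)) (v : Fin n → ℝ) :
    permVec π⁻¹ (permVec π v) = v := by
  funext i; simp [permVec]

lemma permVec_sub {n : ℕ} (π : Equiv.Perm (Fin n)) (v w : Fin n → ℝ) :
    permVec π (v - w) = permVec π v - permVec π w := rfl

lemma permVec_add {n : ℕ} (π : Equiv.Perm (Fin n)) (v w : Fin n → ℝ) :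
    permVec π (v + w) = permVec π v + permVec π w := rfl

lemma permVec_smul {n : ℕ} (π : Equiv.Perm (Fin n)) (a : ℝ) (v : Fin n → ℝ) :
    permVec π (a • v) = a • permVec π v := rfl

lemma l2_permVec_sub {n : ℕ} (π : Equiv.Perm (Fin n)) (v y : Fin n → ℝ) :
    l2 (permVec π v - y) = l2 (v - permVec π⁻¹ y) := by
  rw [← l2_permVec π⁻¹, permVec_sub, permVec_inv]

lemma dH_inv {n : ℕ} (π : Equiv.Perm (Fin n)) : dH π⁻¹ = dH π := by
  unfold dH
  congr 1
  ext i
  simp only [Finset.mem_filter, Finset.mem_univ, true_and, ne_eq, Equiv.Perm.inv_eq_iff_eq]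
  exact not_congr eq_comm

lemma setT_neg {n k : ℕ} {πs : Equiv.Perm (Fin n)} {t : Fin n → ℝ} (ht : t ∈ setT n k πs) :
    -t ∈ setT n k πs := by
  obtain ⟨⟨σ, hσ, v, rfl⟩, h1⟩ := ht
  refine ⟨⟨σ, hσ, -v, ?_⟩, by rw [l2_neg]; exact h1⟩
  funext i; simp [permVec]; ring

lemma projM_range {n d : ℕ} (X : Matrix (Fin n) (Fin d) ℝ) (v : Fin n → ℝ) :
    ∃ u, projM X *ᵥ v = X *ᵥ u :=
  ⟨((Xᵀ * X)⁻¹ * Xᵀ) *ᵥ v, by rw [mulVec_mulVec, projM, Matrix.mul_assoc]⟩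

lemma det_bound {n d k : ℕ} {σ : ℝ} (hσ : 0 < σ) (X : Matrix (Fin n) (Fin d) ℝ)
    (πs Ph : Equiv.Perm (Fin n)) (βs βh : Fin d → ℝ) (e0 g : Fin n → ℝ)
    (hg : g = σ⁻¹ • permVec πs⁻¹ e0) {ε κ c1 c2 : ℝ} (hε : 0 < ε) (hκ : 0 < κ) (hc1 : 0 ≤ c1)
    (hs : dH πs ≤ k) (hh : dH Ph ≤ k)
    (hmin : ∀ π' : Equiv.Perm (Fin n), dH π' ≤ k → ∀ b : Fin d → ℝ,
      l2 (permVec Ph (X *ᵥ βh) - (permVec πs (X *ᵥ βs) + e0)) ^ 2 ≤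
      l2 (permVec π' (X *ᵥ b) - (permVec πs (X *ᵥ βs) + e0)) ^ 2)
    (hb1 : ∀ t ∈ setT n k πs, ∀ u, ε ≤ l2 (X *ᵥ u - t))
    (hb2 : ∀ u, κ * l2 u ≤ l2 (X *ᵥ u))
    (hn1 : ∀ t ∈ setT n k πs, t ⬝ᵥ (g - projM X *ᵥ g) ≤ c1)
    (hn2 : l2 (projM X *ᵥ g) ≤ c2) :
    l2 (βh - βs) ≤ σ / κ * (c2 + 2 * (ε ^ 2)⁻¹ * c1) := by
  set P := projM X with hP
  set y := permVec πs (X *ᵥ βs) + e0 with hy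
  set a := permVec πs⁻¹ e0 with ha
  have hag : a = σ • g := by rw [hg, smul_smul, mul_inv_cancel₀ hσ.ne', one_smul]
  have hz : permVec πs⁻¹ y = X *ᵥ βs + a := by rw [hy, permVec_add, permVec_inv]
  set e := permVec Ph⁻¹ y - permVec πs⁻¹ y with he
  set q := a + e with hq
  have hz2 : permVec Ph⁻¹ y = X *ᵥ βs + q := by
    have : permVec Ph⁻¹ y = permVec πs⁻¹ y + e := by rw [he]; abel
    rw [this, hz, hq]; abel
  set h := βh - βs with hh'
  have hXh : X *ᵥ βh - permVec Ph⁻¹ y = X *ᵥ h - q := by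
    rw [hz2, hh', mulVec_sub]; abel
  have m1 : ∀ b, l2 (X *ᵥ h - q) ^ 2 ≤ l2 (X *ᵥ b - q) ^ 2 := by
    intro b
    have := hmin Ph hh (b + βs)
    rw [l2_permVec_sub, l2_permVec_sub, hXh, hz2, mulVec_add] at this
    have e1 : X *ᵥ b + X *ᵥ βs - (X *ᵥ βs + q) = X *ᵥ b - q := by abel
    rwa [e1] at this
  have m2 : ∀ b, l2 (X *ᵥ h - q) ^ 2 ≤ l2 (X *ᵥ b - a) ^ 2 := by
    intro b
    have := hmin πs hs (b + βs)
    rw [l2_permVec_sub, l2_permVec_sub, hXh, hz, mulVec_add] at this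
    have e1 : X *ᵥ b + X *ᵥ βs - (X *ᵥ βs + a) = X *ᵥ b - a := by abel
    rwa [e1] at this
  have hPX := projM_mulVec_X X hκ hb2
  have hXhP : X *ᵥ h = P *ᵥ q := by
    obtain ⟨b, hb⟩ := projM_range X q
    have h1 := m1 b
    rw [← hb] at h1
    have h2 : l2 (X *ᵥ h - q) ^ 2 = l2 (X *ᵥ h - P *ᵥ q) ^ 2 + l2 (P *ᵥ q - q) ^ 2 := by
      have e1 : (X *ᵥ h) ⬝ᵥ q = (X *ᵥ h) ⬝ᵥ (P *ᵥ q) := by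
        rw [← projM_dot, hPX]
      have e2 : (P *ᵥ q) ⬝ᵥ q = l2 (P *ᵥ q) ^ 2 := by rw [projM_sq, projM_dot]
      rw [l2_sub_sq, l2_sub_sq, l2_sub_sq, e1, e2]; ring
    have h3 : l2 (X *ᵥ h - P *ᵥ q) ^ 2 = 0 := le_antisymm (by linarith) (sq_nonneg _)
    have h4 : l2 (X *ᵥ h - P *ᵥ q) = 0 := by simpa using h3
    exact sub_eq_zero.1 (l2_eq_zero h4)
  have hpy : ∀ v, l2 (P *ᵥ v - v) ^ 2 = l2 v ^ 2 - v ⬝ᵥ (P *ᵥ v) := by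
    intro v
    rw [l2_sub_sq, projM_sq, projM_dot]; ring
  have hQ : l2 (P *ᵥ e - e) ^ 2 ≤ -2 * (e ⬝ᵥ (a - P *ᵥ a)) := by
    obtain ⟨b, hb⟩ := projM_range X a
    have h1 := m2 b
    rw [← hb, hXhP, hpy, hpy] at h1
    rw [hpy]
    have e1 : a ⬝ᵥ (P *ᵥ e) = e ⬝ᵥ (P *ᵥ a) := by rw [← projM_dot, dotProduct_comm]
    rw [hq, mulVec_add, l2_sq, l2_sq] at h1
    simp only [add_dotProduct, dotProduct_add] at h1
    have e3 := dotProduct_sub e a (P *ᵥ a)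
    rw [l2_sq]
    rw [e1, dotProduct_comm a e] at h1
    linarith
  have hE : l2 e ≤ 2 * (ε ^ 2)⁻¹ * (σ * c1) := by
    rcases eq_or_lt_of_le (l2_nonneg e) with h0 | h0
    · rw [← h0]; positivity
    set t := (l2 e)⁻¹ • e with ht
    have het : e = l2 e • t := by rw [ht, smul_smul, mul_inv_cancel₀ h0.ne', one_smul]
    have htT : t ∈ setT n k πs := by
      refine ⟨⟨Ph⁻¹, by rw [dH_inv]; exact hh, (l2 e)⁻¹ • y, ?_⟩, ?_⟩
      · rw [permVec_smul, permVec_smul, ← smul_sub]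
      · rw [ht, l2_smul, abs_of_pos (inv_pos.2 h0), inv_mul_cancel₀ h0.ne']
    obtain ⟨u, hu⟩ := projM_range X t
    have h1 := hb1 t htT u
    rw [← hu] at h1
    have h2 : l2 (P *ᵥ e - e) = l2 e * l2 (P *ᵥ t - t) := by
      conv_lhs => rw [het]
      rw [mulVec_smul, ← smul_sub, l2_smul, abs_of_pos h0]
    have h3 := hn1 (-t) (setT_neg htT)
    have h4 : e ⬝ᵥ (a - P *ᵥ a) = -(l2 e * (σ * ((-t) ⬝ᵥ (g - P *ᵥ g)))) := by
      rw [hag, mulVec_smul, ← smul_sub]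
      conv_lhs => rw [het]
      rw [smul_dotProduct, dotProduct_smul, neg_dotProduct, smul_eq_mul, smul_eq_mul]; ring
    rw [h2, h4, mul_pow] at hQ
    have h5 : ε ^ 2 ≤ l2 (P *ᵥ t - t) ^ 2 := by gcongr
    have h6 : l2 e * (l2 e * ε ^ 2) ≤ l2 e * (2 * (σ * c1)) := by
      have := mul_le_mul_of_nonneg_left h5 (sq_nonneg (l2 e))
      have h7 := mul_le_mul_of_nonneg_left (mul_le_mul_of_nonneg_left h3 hσ.le) h0.le
      nlinarith
    have h8 := le_of_mul_le_mul_left h6 h0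
    have : 2 * (ε ^ 2)⁻¹ * (σ * c1) = 2 * (σ * c1) / ε ^ 2 := by field_simp
    rw [this, le_div_iff₀ (by positivity)]
    exact h8
  have hf : κ * l2 h ≤ σ * c2 + 2 * (ε ^ 2)⁻¹ * (σ * c1) := by
    refine (hb2 h).trans ?_
    rw [hXhP, hq, mulVec_add]
    refine (l2_add_le _ _).trans (add_le_add ?_ ((projM_l2_le X e).trans hE))
    rw [hag, mulVec_smul, l2_smul, abs_of_pos hσ]
    exact mul_le_mul_of_nonneg_left hn2 hσ.le
  rw [div_mul_eq_mul_div, le_div_iff₀ hκ]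
  linarith

lemma ev_lt {f g : ℝ → ℝ} (hf : Continuous f) (hg : Continuous g) (h : f 0 < g 0) :
    ∀ᶠ δ in nhds (0 : ℝ), f δ < g δ :=
  hf.continuousAt.eventually_lt hg.continuousAt h

lemma strict_key {ε r : ℝ} (hε : 0 < ε) (hε2 : ε < 1 / 2) (hr : 0 < r) (hr4 : r < 1 / 4) :
    ((1 - ε) * Real.sqrt (1 - r) + ε * Real.sqrt r) ^ 2 < (1 - ε ^ 2) * (1 - r) := by
  set x := Real.sqrt (1 - r)
  set y := Real.sqrt r
  have hx : x ^ 2 = 1 - r := Real.sq_sqrt (by linarith)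
  have hy : y ^ 2 = r := Real.sq_sqrt hr.le
  have hx0 : 0 < x := Real.sqrt_pos.2 (by linarith)
  have hy0 : 0 < y := Real.sqrt_pos.2 hr
  have h1 : y < 3 / 5 * x := by
    apply lt_of_pow_lt_pow_left₀ 2 (by positivity)
    rw [mul_pow, hx, hy]; linarith
  have h2 : (1 - ε) * x + ε * y < (1 - 2 / 5 * ε) * x := by nlinarith
  have h0 : 0 ≤ (1 - ε) * x + ε * y := by
    have : 0 < 1 - ε := by linarith
    positivity
  have h3 : ((1 - ε) * x + ε * y) ^ 2 < ((1 - 2 / 5 * ε) * x) ^ 2 := by gcongr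
  refine h3.trans_le ?_
  rw [mul_pow, hx]
  apply mul_le_mul_of_nonneg_right _ (by linarith)
  nlinarith

lemma exists_delta {ε r : ℝ} (hε : 0 < ε) (hε2 : ε < 1 / 2) (hr : 0 < r) (hr4 : r < 1 / 4) :
    ∃ δ : ℝ, 0 < δ ∧ δ < 1 / 5 ∧ 0 < (1 - δ) ^ 2 - (ε + δ) ^ 2 ∧
      ((1 - δ) ^ 2 * ((1 + δ) * ((1 - ε) * Real.sqrt (1 - r)) + 7 * δ)
        + (ε + δ) * (δ + Real.sqrt ((1 + δ) * r))) ^ 2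
        ≤ ((1 - δ) ^ 2 - (ε + δ) ^ 2) * ((1 - δ) ^ 3 - (δ + Real.sqrt ((1 + δ) * r)) ^ 2) ∧
      (1 - 2 * Real.sqrt r) + 2 * δ ≤ (1 - δ) * Real.sqrt (1 - δ) - Real.sqrt ((1 + δ) * r) ∧
      2 * Real.sqrt ((1 + δ) * r) + 3 * δ + 14 * δ * (ε ^ 2)⁻¹ ≤ Real.sqrt (5 * r) := by
  have hsr : 0 < Real.sqrt r := Real.sqrt_pos.2 hr
  have e1 := ev_lt (f := fun _ => 0) (g := fun δ => (1 - δ) ^ 2 - (ε + δ) ^ 2)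
    continuous_const (by fun_prop) (by nlinarith)
  have e2 := ev_lt (f := fun δ => ((1 - δ) ^ 2 * ((1 + δ) * ((1 - ε) * Real.sqrt (1 - r)) + 7 * δ)
        + (ε + δ) * (δ + Real.sqrt ((1 + δ) * r))) ^ 2)
    (g := fun δ => ((1 - δ) ^ 2 - (ε + δ) ^ 2) *
      ((1 - δ) ^ 3 - (δ + Real.sqrt ((1 + δ) * r)) ^ 2))
    (by fun_prop) (by fun_prop) (by
      have := strict_key hε hε2 hr hr4
      simp only [sub_zero, add_zero, zero_add, one_pow, one_mul, mul_zero, Real.sq_sqrt hr.le]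
      exact this)
  have e3 := ev_lt (f := fun δ => (1 - 2 * Real.sqrt r) + 2 * δ)
    (g := fun δ => (1 - δ) * Real.sqrt (1 - δ) - Real.sqrt ((1 + δ) * r))
    (by fun_prop) (by fun_prop) (by simp; linarith)
  have e4 := ev_lt (f := fun δ => 2 * Real.sqrt ((1 + δ) * r) + 3 * δ + 14 * δ * (ε ^ 2)⁻¹)
    (g := fun _ => Real.sqrt (5 * r)) (by fun_prop) continuous_const (by
      simp only [mul_zero, add_zero, zero_mul, one_mul]
      apply Real.lt_sqrt_of_sq_lt
      rw [mul_pow, Real.sq_sqrt hr.le]; linarith)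
  have e5 : ∀ᶠ δ in nhdsWithin (0 : ℝ) (Set.Ioi 0), δ ∈ Set.Ioo (0 : ℝ) (1 / 5) :=
    Ioo_mem_nhdsGT (by norm_num)
  have hall := e5.and (((e1.and e2).and (e3.and e4)).filter_mono nhdsWithin_le_nhds)
  obtain ⟨δ, h5, ⟨h1, h2⟩, h3, h4⟩ := hall.exists
  exact ⟨δ, h5.1, h5.2, h1, h2.le, h3.le, h4.le⟩

lemma rate_choice {C c1 : ℝ} (hC : 1 ≤ C) (hc1 : 0 < c1) :
    ∃ c : ℝ, 0 < c ∧ ∀ (N p : ℝ), p ≤ 1 → p ≤ C * Real.exp (-c1 * N) →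
      p ≤ 7 / 2 * Real.exp (-c * N) := by
  set L := Real.log C
  have hL : 0 ≤ L := Real.log_nonneg hC
  refine ⟨c1 / (1 + L), by positivity, fun N p hp1 hp => ?_⟩
  have hCL : C = Real.exp L := (Real.exp_log (by linarith)).symm
  rw [hCL, ← Real.exp_add] at hp
  have h1 : p ≤ Real.exp ((1 + L)⁻¹ * (L + -c1 * N)) := by
    rcases le_total 0 (L + -c1 * N) with h | h
    · exact hp1.trans (Real.one_le_exp (by positivity))
    · refine hp.trans (Real.exp_le_exp.2 ?_)
      have : (1 + L)⁻¹ ≤ 1 := inv_le_one_of_one_le₀ (by linarith)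
      nlinarith
  refine h1.trans ?_
  have e : (1 + L)⁻¹ * (L + -c1 * N) = L / (1 + L) + -(c1 / (1 + L)) * N := by field_simp
  rw [e, Real.exp_add]
  refine mul_le_mul_of_nonneg_right ?_ (Real.exp_pos _).le
  have : L / (1 + L) ≤ 1 := by rw [div_le_one (by linarith)]; linarith
  have h2 := Real.exp_le_exp.2 this
  have := Real.exp_one_lt_d9
  linarith

lemma width_bound {n d : ℕ} {ε r w : ℝ} (hε : 0 < ε) (hε2 : ε < 1 / 2) (hd : 4 * d < n)
    (hr : r = d / n) (h : nu (n - d) - (ε / (1 - ε)) * nu n ≥ (2 / (1 - ε)) * w) :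
    2 * w ≤ (1 - ε) * (Real.sqrt (1 - r) * Real.sqrt n) := by
  have h1 : 0 < 1 - ε := by linarith
  have hn : (0 : ℝ) < n := by exact_mod_cast (by omega : 0 < n)
  have h2 := nu_le (n - d) (by omega)
  have h3 : 0 ≤ ε / (1 - ε) * nu n := mul_nonneg (by positivity) (nu_nonneg n)
  have h4 : ((n - d : ℕ) : ℝ) = (1 - r) * n := by
    rw [Nat.cast_sub (by omega), hr]; field_simp
  rw [h4, Real.sqrt_mul' _ hn.le] at h2
  have h5 : 2 / (1 - ε) * w ≤ Real.sqrt (1 - r) * Real.sqrt n := by linarith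
  have h6 := mul_le_mul_of_nonneg_left h5 h1.le
  have h7 : (1 - ε) * (2 / (1 - ε) * w) = 2 * w := by field_simp
  linarith

lemma data_fst {n d : ℕ} {σ : ℝ} (S : Set (Fin n → Fin d → ℝ)) :
    μData n d σ {ω | ω.1 ∈ S} = μX n d S := by
  haveI := noise_prob (n := n) σ
  have : {ω : (Fin n → Fin d → ℝ) × (Fin n → ℝ) | ω.1 ∈ S} = S ×ˢ Set.univ := by ext; simp
  rw [this, μData, Measure.prod_prod, measure_univ, mul_one]

set_option maxHeartbeats 1000000 in
lemma main_prob {ε r : ℝ} (hε : 0 < ε) (hε2 : ε < 1 / 2) (hr : 0 < r) (hr4 : r < 1 / 4) :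
    ∃ c : ℝ, 0 < c ∧ ∀ (n d k : ℕ) (σ : ℝ) (βs : Fin d → ℝ) (πs : Equiv.Perm (Fin n)),
      0 < σ → dH πs ≤ k → r = d / n →
      nu (n - d) - (ε / (1 - ε)) * nu n ≥ (2 / (1 - ε)) * gwidth (setT n k πs) →
      4 * d < n → 0 < d →
      ∀ (Phat : Ω n d → Equiv.Perm (Fin n)) (βhat : Ω n d → Fin d → ℝ),
      (∀ ω, dH (Phat ω) ≤ k) →
      (∀ ω : Ω n d, ∀ π' : Equiv.Perm (Fin n), dH π' ≤ k → ∀ b : Fin d → ℝ,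
          l2 (permVec (Phat ω) (desX ω *ᵥ βhat ω) - (permVec πs (desX ω *ᵥ βs) + ω.2)) ^ 2 ≤
          l2 (permVec π' (desX ω *ᵥ b) - (permVec πs (desX ω *ᵥ βs) + ω.2)) ^ 2) →
      μData n d σ {ω | ¬ l2 (βhat ω - βs) ≤ σ / (1 - 2 * Real.sqrt r) *
        (Real.sqrt (5 * r) + 2 * (1 + Real.sqrt 2) * (ε ^ 2)⁻¹ *
          (gwidth (setT n k πs) / Real.sqrt n))}
        ≤ ENNReal.ofReal (7 / 2 * Real.exp (-c * n)) := by
  obtain ⟨δ, hδ, hδ5, hA, hB, hκ, hfin⟩ := exists_delta hε hε2 hr hr4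
  have hδ1 : δ < 1 := by linarith
  set E : ℝ := 2 * (1 + δ) / δ with hE
  have hE0 : 0 < E := by positivity
  set a1 := chiRate (-δ) with ha1
  set a2 := chiRate δ with ha2
  have p1 : 0 < a1 := chiRate_pos (by linarith)
  have p2 : 0 < a2 := chiRate_pos (by linarith)
  have l1 : a1 < 1 := chiRate_lt_one (by linarith) (by linarith)
  have l2' : a2 < 1 := chiRate_lt_one (by linarith) (by linarith)
  set c1 := min (min (-Real.log a1) (-(r * Real.log a2))) (δ ^ 2 / 2) with hc1
  have hc10 : 0 < c1 := by
    refine lt_min (lt_min ?_ ?_) (by positivity)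
    · linarith [Real.log_neg p1 l1]
    · nlinarith [Real.log_neg p2 l2']
  obtain ⟨c, hc0, hc⟩ := rate_choice (C := 4 * E + 6) (c1 := c1) (by linarith) hc10
  refine ⟨c, hc0, ?_⟩
  intro n d k σ βs πs hσ hs hrd hwid hdn hd Phat βhat hPh hmin
  have hn : 0 < n := by omega
  have hn' : (0 : ℝ) < n := by exact_mod_cast hn
  have hsn : 0 < Real.sqrt n := Real.sqrt_pos.2 hn'
  haveI := noise_prob (n := n) σ
  set T := setT n k πs with hTdef
  have hT : ∀ t ∈ T, l2 t = 1 := fun t ht => ht.2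
  set w := gwidth T with hw
  have hw0 : 0 ≤ w := gwidth_nonneg T
  have b1 := event_b1 (n := n) (d := d) hn hT hε hδ hδ1 hrd
    (width_bound hε hε2 hdn hrd hwid) rfl rfl rfl rfl rfl hA hB
  have b2 := event_b2 (n := n) (d := d) hn hδ hδ1 hrd hκ
  have b3 := event_noise (n := n) (d := d) hn hd hσ πs (fun t ht => (hT t ht).le) hδ hδ1
  rw [← data_fst (σ := σ)] at b1 b2
  set S := {ω : Ω n d | ¬ l2 (βhat ω - βs) ≤ σ / (1 - 2 * Real.sqrt r) *
        (Real.sqrt (5 * r) + 2 * (1 + Real.sqrt 2) * (ε ^ 2)⁻¹ * (w / Real.sqrt n))} with hS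
  have hκ0 : 0 < 1 - 2 * Real.sqrt r := by
    have : Real.sqrt r < 1 / 2 := by
      rw [Real.sqrt_lt' (by norm_num)]; linarith
    linarith
  have hsub : S ⊆ ({ω | ω.1 ∈ {X | ¬ ∀ t ∈ T, ∀ u : Fin d → ℝ, ε ≤ l2 ((fun r => u ⬝ᵥ X r) - t)}} ∪
      {ω | ω.1 ∈ {X | ¬ ∀ u : Fin d → ℝ, (1 - 2 * Real.sqrt r) * Real.sqrt n * l2 u
        ≤ l2 (fun r => u ⬝ᵥ X r)}}) ∪ {ω | (∃ t ∈ T, 2 * (1 + δ) * gwidth T + 7 * δ * Real.sqrt n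
        < t ⬝ᵥ (σ⁻¹ • permVec πs⁻¹ ω.2 - projM (Matrix.of ω.1) *ᵥ (σ⁻¹ • permVec πs⁻¹ ω.2))) ∨
      2 * Real.sqrt ((1 + δ) * d) + 3 * (δ * Real.sqrt n)
        < l2 (projM (Matrix.of ω.1) *ᵥ (σ⁻¹ • permVec πs⁻¹ ω.2)) } := by
    intro ω hω
    by_contra hh
    simp only [Set.mem_union, Set.mem_setOf_eq, not_or, not_not, not_exists, not_and, not_lt] at hh
    obtain ⟨⟨h1, h2⟩, h3, h4⟩ := hh
    apply hω
    have ex : ∀ u : Fin d → ℝ, (fun r => u ⬝ᵥ ω.1 r) = desX ω *ᵥ u := by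
      intro u; funext i; exact dotProduct_comm _ _
    simp only [ex] at h1 h2
    have := det_bound hσ (desX ω) πs (Phat ω) βs (βhat ω) ω.2 _ rfl hε
      (mul_pos hκ0 hsn) (by positivity) hs (hPh ω) (hmin ω) h1 h2 h3 h4
    refine this.trans ?_
    have ed : Real.sqrt ((1 + δ) * d) = Real.sqrt ((1 + δ) * r) * Real.sqrt n := by
      rw [← Real.sqrt_mul (by positivity)]
      congr 1
      rw [hrd]; field_simp
    rw [ed]
    have e1 : σ / ((1 - 2 * Real.sqrt r) * Real.sqrt n) *
        (2 * (Real.sqrt ((1 + δ) * r) * Real.sqrt n) + 3 * (δ * Real.sqrt n) +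
          2 * (ε ^ 2)⁻¹ * (2 * (1 + δ) * w + 7 * δ * Real.sqrt n))
        = σ / (1 - 2 * Real.sqrt r) * ((2 * Real.sqrt ((1 + δ) * r) + 3 * δ + 14 * δ * (ε ^ 2)⁻¹)
          + 4 * (1 + δ) * ((ε ^ 2)⁻¹ * (w / Real.sqrt n))) := by
      field_simp
      ring
    rw [e1]
    refine mul_le_mul_of_nonneg_left (add_le_add hfin ?_) (by positivity)
    rw [mul_assoc (2 * (1 + Real.sqrt 2))]
    refine mul_le_mul_of_nonneg_right ?_ (by positivity)
    have : (7 / 5 : ℝ) ≤ Real.sqrt 2 := Real.le_sqrt_of_sq_le (by norm_num)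
    linarith
  have hle := (measure_mono (μ := μData n d σ) hsub).trans ((measure_union_le _ _).trans
    (add_le_add ((measure_union_le _ _).trans (add_le_add b1 b2)) b3))
  set x := Real.exp (-c1 * n) with hx
  have x0 : 0 < x := Real.exp_pos _
  have y1 : a1 ^ n ≤ x := by
    rw [← Real.exp_log p1, ← Real.exp_nat_mul, hx]
    apply Real.exp_le_exp.2
    have : c1 ≤ -Real.log a1 := (min_le_left _ _).trans (min_le_left _ _)
    have hm := mul_le_mul_of_nonneg_right this hn'.le
    linarith only [hm]
  have y2 : a2 ^ d ≤ x := by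
    rw [← Real.exp_log p2, ← Real.exp_nat_mul, hx]
    apply Real.exp_le_exp.2
    have : c1 ≤ -(r * Real.log a2) := (min_le_left _ _).trans (min_le_right _ _)
    have e : (d : ℝ) = r * n := by rw [hrd]; field_simp
    rw [e]
    have hm := mul_le_mul_of_nonneg_right this hn'.le
    linarith only [hm]
  have y3 : Real.exp (-(δ ^ 2 / 2) * n) ≤ x := by
    rw [hx]
    apply Real.exp_le_exp.2
    have : c1 ≤ δ ^ 2 / 2 := min_le_right _ _
    have hm := mul_le_mul_of_nonneg_right this hn'.le
    linarith only [hm]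
  have y4 : E * Real.exp (-(δ ^ 2 / 2) * n) ≤ E * x := mul_le_mul_of_nonneg_left y3 hE0.le
  have hreal : μData n d σ S ≤ ENNReal.ofReal ((4 * E + 6) * x) := by
    refine hle.trans ?_
    have e3 : (3 : ENNReal) = ENNReal.ofReal 3 := by simp
    rw [e3, ← ENNReal.ofReal_mul (by norm_num), ← ENNReal.ofReal_add (by positivity) (by positivity),
      ← ENNReal.ofReal_add (by positivity) (by positivity),
      ← ENNReal.ofReal_add (by positivity) (by positivity),
      ← ENNReal.ofReal_add (by positivity) (by positivity),
      ← ENNReal.ofReal_add (by positivity) (by positivity),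
      ← ENNReal.ofReal_add (by positivity) (by positivity),
      ← ENNReal.ofReal_add (by positivity) (by positivity)]
    apply ENNReal.ofReal_le_ofReal
    linarith
  have hne : μData n d σ S ≠ ⊤ := measure_ne_top _ _
  rw [← ENNReal.ofReal_toReal hne]
  apply ENNReal.ofReal_le_ofReal
  refine hc n _ ?_ ?_
  · exact ENNReal.toReal_le_of_le_ofReal (by norm_num) (by simpa using prob_le_one)
  · exact ENNReal.toReal_le_of_le_ofReal (by positivity) hreal

/-- **Theorem 1 (constrained least squares with a k-sparse permutation).**
Under the model `y = Π* X β* + ε` with `Π*` `k`-sparse, if `ε₀ ∈ (0, 1/2)` satisfies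
`ν_{n-d} - (ε₀/(1-ε₀)) ν_n ≥ (2/(1-ε₀)) w(T)` and `n > max(9, 4d)`, then there is a constant
`c_{ε₀} > 0` depending only on `ε₀` and `d/n` such that any minimizer `(Π̂, β̂)` of
`‖Π X β - y‖₂²` over `P_{n,k} × ℝ^d` satisfies, with probability at least
`1 - (7/2) exp(-c_{ε₀} n) - 2 exp(-(1/2) max(d, log n))`,
`‖β̂ - β*‖₂ ≤ σ/(1 - √(max(4d, log n)/n)) (√(5 max(d, log n)/n)
  + 2(1+√2) ε₀⁻² max(w(T), log n)/√n)`. -/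
theorem constrained_ls_sparse_permutation :
    ∃ c : ℝ → ℝ → ℝ,
      ∀ (n d k : ℕ) (σ : ℝ) (βs : Fin d → ℝ) (πs : Equiv.Perm (Fin n)) (ε₀ : ℝ),
      0 < σ → dH πs ≤ k →
      ε₀ ∈ Set.Ioo (0 : ℝ) (1 / 2) →
      nu (n - d) - (ε₀ / (1 - ε₀)) * nu n ≥ (2 / (1 - ε₀)) * gwidth (setT n k πs) →
      max 9 (4 * d) < n →
      ∀ (Phat : Ω n d → Equiv.Perm (Fin n)) (βhat : Ω n d → Fin d → ℝ),
      (∀ ω, dH (Phat ω) ≤ k) →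
      (∀ ω : Ω n d, ∀ π' : Equiv.Perm (Fin n), dH π' ≤ k → ∀ b : Fin d → ℝ,
          l2 (permVec (Phat ω) (desX ω *ᵥ βhat ω) - (permVec πs (desX ω *ᵥ βs) + ω.2)) ^ 2 ≤
          l2 (permVec π' (desX ω *ᵥ b) - (permVec πs (desX ω *ᵥ βs) + ω.2)) ^ 2) →
      0 < c ε₀ ((d : ℝ) / n) ∧
      μData n d σ
          {ω : Ω n d |
            l2 (βhat ω - βs) ≤
              σ / (1 - Real.sqrt (max (4 * (d : ℝ)) (Real.log n) / n)) *
                (Real.sqrt (5 * max (d : ℝ) (Real.log n) / n) +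
                  2 * (1 + Real.sqrt 2) * (ε₀ ^ 2)⁻¹ *
                    max (gwidth (setT n k πs)) (Real.log n) / Real.sqrt n)}
        ≥ ENNReal.ofReal (1 - (7 / 2) * Real.exp (-(c ε₀ ((d : ℝ) / n)) * n)
            - 2 * Real.exp (-(1 / 2) * max (d : ℝ) (Real.log n))) := by
  classical
  refine ⟨fun ε r => if h : (0 < ε ∧ ε < 1 / 2) ∧ (0 < r ∧ r < 1 / 4) then
    (main_prob h.1.1 h.1.2 h.2.1 h.2.2).choose else 1, ?_⟩
  intro n d k σ βs πs ε₀ hσ hs hε hwid hmax Phat βhat hPh hmin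
  beta_reduce
  have hn9 : 9 < n := lt_of_le_of_lt (le_max_left _ _) hmax
  have hdn : 4 * d < n := lt_of_le_of_lt (le_max_right _ _) hmax
  have hn' : (0 : ℝ) < n := by exact_mod_cast (by omega : 0 < n)
  have hdn' : 4 * (d : ℝ) < n := by exact_mod_cast hdn
  haveI := noise_prob (n := n) σ
  set w := gwidth (setT n k πs) with hw
  have hw0 : 0 ≤ w := gwidth_nonneg _
  have hε0 : 0 < ε₀ := hε.1
  have hden : 0 < 1 - Real.sqrt (max (4 * (d : ℝ)) (Real.log n) / n) := by
    rw [sub_pos, Real.sqrt_lt' one_pos, one_pow, div_lt_one hn']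
    exact max_lt hdn' (by linarith [Real.log_le_sub_one_of_pos hn'])
  rcases Nat.eq_zero_or_pos d with hd0 | hd
  · subst hd0
    have hc : ¬ ((0 < ε₀ ∧ ε₀ < 1 / 2) ∧ (0 < ((0 : ℕ) : ℝ) / n ∧ ((0 : ℕ) : ℝ) / n < 1 / 4)) := by
      simp
    rw [dif_neg hc]
    refine ⟨one_pos, ?_⟩
    refine le_trans ?_ (le_trans (le_of_eq (measure_univ (μ := μData n 0 σ)).symm) (measure_mono ?_))
    · rw [← ENNReal.ofReal_one]
      apply ENNReal.ofReal_le_ofReal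
      have h1 := Real.exp_pos (-(1 : ℝ) * n)
      have h2 := Real.exp_pos (-(1 / 2) * max ((0 : ℕ) : ℝ) (Real.log n))
      linarith
    · intro ω _
      have h0 : βhat ω - βs = 0 := Subsingleton.elim _ _
      rw [Set.mem_setOf_eq, h0, l2_zero]
      have : 0 ≤ max w (Real.log n) := hw0.trans (le_max_left _ _)
      positivity
  · have hd' : (0 : ℝ) < d := by exact_mod_cast hd
    have hc : (0 < ε₀ ∧ ε₀ < 1 / 2) ∧ (0 < (d : ℝ) / n ∧ (d : ℝ) / n < 1 / 4) := by
      refine ⟨hε, by positivity, ?_⟩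
      rw [div_lt_iff₀ hn']; linarith
    rw [dif_pos hc]
    have hspec := (main_prob hc.1.1 hc.1.2 hc.2.1 hc.2.2).choose_spec
    set c := (main_prob hc.1.1 hc.1.2 hc.2.1 hc.2.2).choose
    refine ⟨hspec.1, ?_⟩
    have hb := hspec.2 n d k σ βs πs hσ hs rfl hwid hdn hd Phat βhat hPh hmin
    set S := {ω : Ω n d | ¬ l2 (βhat ω - βs) ≤ σ / (1 - 2 * Real.sqrt ((d : ℝ) / n)) *
        (Real.sqrt (5 * ((d : ℝ) / n)) + 2 * (1 + Real.sqrt 2) * (ε₀ ^ 2)⁻¹ *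
          (w / Real.sqrt n))} with hS
    have hsub : Sᶜ ⊆ {ω : Ω n d |
            l2 (βhat ω - βs) ≤
              σ / (1 - Real.sqrt (max (4 * (d : ℝ)) (Real.log n) / n)) *
                (Real.sqrt (5 * max (d : ℝ) (Real.log n) / n) +
                  2 * (1 + Real.sqrt 2) * (ε₀ ^ 2)⁻¹ *
                    max w (Real.log n) / Real.sqrt n)} := by
      intro ω hω
      simp only [hS, Set.mem_compl_iff, Set.mem_setOf_eq, not_not] at hω
      refine hω.trans ?_
      have e1 : 2 * Real.sqrt ((d : ℝ) / n) ≤ Real.sqrt (max (4 * (d : ℝ)) (Real.log n) / n) := by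
        apply Real.le_sqrt_of_sq_le
        rw [mul_pow, Real.sq_sqrt (by positivity)]
        have : (2 : ℝ) ^ 2 * (d / n) = 4 * d / n := by ring
        rw [this]
        gcongr
        exact le_max_left _ _
      have e2 : Real.sqrt (5 * ((d : ℝ) / n)) ≤ Real.sqrt (5 * max (d : ℝ) (Real.log n) / n) := by
        apply Real.sqrt_le_sqrt
        rw [← mul_div_assoc]
        gcongr
        exact le_max_left _ _
      have e3 : 2 * (1 + Real.sqrt 2) * (ε₀ ^ 2)⁻¹ * (w / Real.sqrt n) ≤
          2 * (1 + Real.sqrt 2) * (ε₀ ^ 2)⁻¹ * max w (Real.log n) / Real.sqrt n := by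
        rw [← mul_div_assoc]
        gcongr
        exact le_max_left _ _
      refine mul_le_mul ?_ (add_le_add e2 e3) (by positivity) (by positivity)
      exact div_le_div_of_nonneg_left hσ.le hden (by linarith)
    refine le_trans ?_ (measure_mono hsub)
    have h1 : 1 ≤ μData n d σ S + μData n d σ Sᶜ := by
      rw [← measure_univ (μ := μData n d σ), ← Set.union_compl_self S]
      exact measure_union_le _ _
    have h2 : ENNReal.ofReal (1 - (7 / 2) * Real.exp (-c * n)
        - 2 * Real.exp (-(1 / 2) * max (d : ℝ) (Real.log n)))
        ≤ 1 - ENNReal.ofReal (7 / 2 * Real.exp (-c * n)) := by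
      rw [← ENNReal.ofReal_one, ← ENNReal.ofReal_sub _ (by positivity)]
      apply ENNReal.ofReal_le_ofReal
      have := Real.exp_pos (-(1 / 2) * max (d : ℝ) (Real.log n))
      linarith
    refine h2.trans ?_
    rw [tsub_le_iff_left]
    exact h1.trans (add_le_add hb le_rfl)

end
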